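/- Let (u,v) ∈ (H¹_loc(ℍⁿ) ∩ C⁰(ℍⁿ)) × (H¹_loc(ℍⁿ) ∩ C⁰(ℍⁿ)) be a positive weak cylindrical solution of −Δ_ℍ u = f(v), −Δ_ℍ v = g(u) on ℍⁿ, with f,g continuous. Then the CR inversions (ū, v̄) form a weak solution of the system −Δ_ℍ ū(ξ) = |ξ|_ℍ^{−(Q+2)} f(|ξ|_ℍ^{Q−2} v̄(ξ)), −Δ_ℍ v̄(ξ) = |ξ|_ℍ^{−(Q+2)} g(|ξ|_ℍ^{Q−2} ū(ξ)) on ℍⁿ∖{0} (tested against φ ∈ C¹_c(ℍⁿ∖{0})). Moreover lim_{|ξ|_ℍ→∞} |ξ|_ℍ^{Q−2} ū(ξ) = u(0) and lim_{|ξ|_ℍ→∞} |ξ|_ℍ^{Q−2} v̄(ξ) = v(0); consequently ū, v̄ ∈ L^{τ+1}(ℍⁿ∖B_r(0)) ∩ L^∞(ℍⁿ∖B_r(0)) for every r > 0, where τ = (Q+2)/(Q−2) and B_r(0) = {ξ : |ξ|_ℍ < r}. -/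

import Mathlib

open MeasureTheory Real Filter Set Topology

noncomputable section

namespace Heisenberg

/-- The underlying space of the Heisenberg group `ℍⁿ`, identified with `ℝⁿ × ℝⁿ × ℝ`
(equipped with Lebesgue measure, which is the Haar measure of `ℍⁿ`). -/
abbrev H (n : ℕ) : Type := (Fin n → ℝ) × (Fin n → ℝ) × ℝ

variable {n : ℕ}

/-- `|x|² + |y|²` for `ξ = (x, y, t)`. -/
def rsq (ξ : H n) : ℝ := ∑ i, (ξ.1 i) ^ 2 + ∑ i, (ξ.2.1 i) ^ 2

/-- The Kaplan gauge `|ξ|_ℍ = ((|x|²+|y|²)² + t²)^{1/4}`. -/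
def gaugeH (ξ : H n) : ℝ := ((rsq ξ) ^ 2 + (ξ.2.2) ^ 2) ^ ((4 : ℝ)⁻¹)

/-- The left-invariant vector field `Xᵢ = ∂_{xᵢ} + 2yᵢ∂_t` applied to `φ`. -/
def Xd (i : Fin n) (φ : H n → ℝ) (ξ : H n) : ℝ :=
  fderiv ℝ φ ξ (Pi.single i 1, 0, 2 * ξ.2.1 i)

/-- The left-invariant vector field `Yᵢ = ∂_{yᵢ} − 2xᵢ∂_t` applied to `φ`. -/
def Yd (i : Fin n) (φ : H n → ℝ) (ξ : H n) : ℝ :=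
  fderiv ℝ φ ξ (0, Pi.single i 1, -(2 * ξ.1 i))

/-- The horizontal gradient `∇_ℍ φ = (X₁φ,…,Xₙφ,Y₁φ,…,Yₙφ)` of a differentiable function. -/
def hGrad (φ : H n → ℝ) (ξ : H n) : (Fin n → ℝ) × (Fin n → ℝ) :=
  (fun i => Xd i φ ξ, fun i => Yd i φ ξ)

/-- Euclidean pairing of two horizontal vectors. -/
def hdot (a b : (Fin n → ℝ) × (Fin n → ℝ)) : ℝ :=
  ∑ i, a.1 i * b.1 i + ∑ i, a.2 i * b.2 i

/-- The (pointwise, classical) sub-Laplacian `Δ_ℍ = ∑ᵢ (Xᵢ² + Yᵢ²)`. -/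
def subLap (u : H n → ℝ) (ξ : H n) : ℝ :=
  ∑ i, Xd i (Xd i u) ξ + ∑ i, Yd i (Yd i u) ξ

/-- `φ ∈ C¹_c(Ω)`. -/
structure IsTest (Ω : Set (H n)) (φ : H n → ℝ) : Prop where
  contDiff : ContDiff ℝ 1 φ
  compactSupport : HasCompactSupport φ
  supportSubset : tsupport φ ⊆ Ω

/-- `G` is a weak horizontal gradient of `u` on `Ω`, with `u` locally integrable on `Ω`
and `G` locally square-integrable on `Ω` (i.e. `u ∈ H¹_loc(Ω)` with horizontal gradient `G`). -/
structure IsWeakHGrad (Ω : Set (H n)) (u : H n → ℝ)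
    (G : H n → (Fin n → ℝ) × (Fin n → ℝ)) : Prop where
  locInt : LocallyIntegrableOn u Ω
  locSq : ∀ K : Set (H n), K ⊆ Ω → IsCompact K → IntegrableOn (fun ξ => ‖G ξ‖ ^ 2) K
  ibpX : ∀ i : Fin n, ∀ φ : H n → ℝ, IsTest Ω φ →
    ∫ ξ, u ξ * Xd i φ ξ = -∫ ξ, (G ξ).1 i * φ ξ
  ibpY : ∀ i : Fin n, ∀ φ : H n → ℝ, IsTest Ω φ →
    ∫ ξ, u ξ * Yd i φ ξ = -∫ ξ, (G ξ).2 i * φ ξ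

/-- `u ∈ H¹_loc(Ω)` is a weak solution of `−Δ_ℍ u = F` on `Ω`:
`∫ ∇_ℍu · ∇_ℍφ = ∫ F φ` for all `φ ∈ C¹_c(Ω)`. -/
def IsWeakSol (Ω : Set (H n)) (u F : H n → ℝ) : Prop :=
  ∃ G : H n → (Fin n → ℝ) × (Fin n → ℝ), IsWeakHGrad Ω u G ∧
    ∀ φ : H n → ℝ, IsTest Ω φ → ∫ ξ, hdot (G ξ) (hGrad φ ξ) = ∫ ξ, F ξ * φ ξ

/-- A function on `ℍⁿ` is cylindrical if it depends only on `r = √(|x|²+|y|²)` and `t`. -/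
def IsCylindrical (u : H n → ℝ) : Prop :=
  ∀ ξ ξ' : H n, rsq ξ = rsq ξ' → ξ.2.2 = ξ'.2.2 → u ξ = u ξ'

/-- The CR-inverted point `ξ̃`. -/
def tilde (ξ : H n) : H n :=
  (fun i => (ξ.1 i * ξ.2.2 + ξ.2.1 i * rsq ξ) / gaugeH ξ ^ 4,
   fun i => (ξ.2.1 i * ξ.2.2 - ξ.1 i * rsq ξ) / gaugeH ξ ^ 4,
   -ξ.2.2 / gaugeH ξ ^ 4)

/-- The CR inversion `ū(ξ) = |ξ|_ℍ^{−(Q−2)} u(ξ̃)`, where `Q − 2 = 2n`. -/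
def crInv (u : H n → ℝ) (ξ : H n) : ℝ := u (tilde ξ) / gaugeH ξ ^ (2 * n)

/-- The critical exponent `τ = (Q+2)/(Q−2)` with `Q = 2n+2`. -/
def tau (n : ℕ) : ℝ := (2 * (n : ℝ) + 4) / (2 * (n : ℝ))

/-- The half space `Σ_λ = {ξ = (x,y,t) : t > λ}`. -/
def Sig (l : ℝ) : Set (H n) := {ξ | l < ξ.2.2}

/-- The H-reflection `ξ_λ = (y, x, 2λ − t)` with respect to the plane `T_λ = {t = λ}`. -/
def hRefl (l : ℝ) (ξ : H n) : H n := (ξ.2.1, ξ.1, 2 * l - ξ.2.2)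

/-- The point `0_λ = (0, 0, 2λ)`. -/
def zl (l : ℝ) : H n := (0, 0, 2 * l)

/-- `U_λ = ū − ū_λ`, where `ū` is the CR inversion of `u` and `ū_λ(ξ) = ū(ξ_λ)`. -/
def Ulam (u : H n → ℝ) (l : ℝ) (ξ : H n) : ℝ := crInv u ξ - crInv u (hRefl l ξ)

/-- `w ∈ L^{τ+1}(Σ_λ) ∩ L^∞(Σ_λ)`. -/
def MemLtau1Linf (l : ℝ) (w : H n → ℝ) : Prop :=
  IntegrableOn (fun ξ => |w ξ| ^ (tau n + 1)) (Sig l) ∧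
    ∃ M : ℝ, ∀ ξ ∈ Sig (n := n) l, |w ξ| ≤ M

/-- `w ∈ H¹(Ω)`: square integrable on `Ω`, with a weak horizontal gradient which is
square integrable on `Ω`. -/
def MemH1 (Ω : Set (H n)) (w : H n → ℝ) : Prop :=
  IntegrableOn (fun ξ => (w ξ) ^ 2) Ω ∧
  ∃ G : H n → (Fin n → ℝ) × (Fin n → ℝ),
    IntegrableOn (fun ξ => ‖G ξ‖ ^ 2) Ω ∧
    (∀ i : Fin n, ∀ φ : H n → ℝ, IsTest Ω φ →
      ∫ ξ, w ξ * Xd i φ ξ = -∫ ξ, (G ξ).1 i * φ ξ) ∧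
    (∀ i : Fin n, ∀ φ : H n → ℝ, IsTest Ω φ →
      ∫ ξ, w ξ * Yd i φ ξ = -∫ ξ, (G ξ).2 i * φ ξ)

end Heisenberg

namespace Heisenberg
variable {n : ℕ}
set_option linter.unusedVariables false

/-- `|ξ|⁴`. -/
def NN (ξ : H n) : ℝ := (rsq ξ) ^ 2 + (ξ.2.2) ^ 2

/-- `|ξ|^{-2n}`. -/
def hh (ξ : H n) : ℝ := NN ξ ^ (-(n : ℝ) / 2)

/-- horizontal vectors -/
abbrev V (n : ℕ) : Type := (Fin n → ℝ) × (Fin n → ℝ)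

lemma rsq_nonneg (ξ : H n) : 0 ≤ rsq ξ := by unfold rsq; positivity

lemma NN_nonneg (ξ : H n) : 0 ≤ NN ξ := by unfold NN; positivity

lemma NN_eq_zero {ξ : H n} : NN ξ = 0 ↔ ξ = 0 := by
  constructor
  · intro h
    unfold NN at h
    have h1 : rsq ξ = 0 := by nlinarith [sq_nonneg (rsq ξ), sq_nonneg ξ.2.2]
    have h2 : ξ.2.2 = 0 := by nlinarith [sq_nonneg (rsq ξ), sq_nonneg ξ.2.2]
    unfold rsq at h1
    have ha : 0 ≤ ∑ i, (ξ.1 i) ^ 2 := by positivity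
    have hb : 0 ≤ ∑ i, (ξ.2.1 i) ^ 2 := by positivity
    have h3 : ∑ i, (ξ.1 i) ^ 2 = 0 := by linarith
    have h4 : ∑ i, (ξ.2.1 i) ^ 2 = 0 := by linarith
    rw [Finset.sum_eq_zero_iff_of_nonneg (fun i _ => sq_nonneg _)] at h3 h4
    ext i
    · simpa using h3 i (Finset.mem_univ i)
    · simpa using h4 i (Finset.mem_univ i)
    · exact h2
  · rintro rfl
    simp [NN, rsq]

lemma NN_pos {ξ : H n} (h : ξ ≠ 0) : 0 < NN ξ :=
  lt_of_le_of_ne (NN_nonneg ξ) (fun h' => h (NN_eq_zero.1 h'.symm))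

lemma gauge_nonneg (ξ : H n) : 0 ≤ gaugeH ξ := Real.rpow_nonneg (NN_nonneg ξ) _

lemma gauge_pow_four (ξ : H n) : gaugeH ξ ^ 4 = NN ξ := by
  change (NN ξ ^ ((4 : ℝ)⁻¹)) ^ 4 = NN ξ
  rw [← Real.rpow_natCast, ← Real.rpow_mul (NN_nonneg ξ)]
  norm_num

lemma gauge_pow_two_n {ξ : H n} (h : ξ ≠ 0) : gaugeH ξ ^ (2 * n) = (hh ξ)⁻¹ := by
  change (NN ξ ^ ((4 : ℝ)⁻¹)) ^ (2 * n) = _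
  unfold hh
  rw [← Real.rpow_natCast, ← Real.rpow_mul (NN_nonneg ξ), ← Real.rpow_neg (NN_nonneg ξ)]
  congr 1
  push_cast
  ring

lemma gauge_pow_two_n_four {ξ : H n} (h : ξ ≠ 0) :
    gaugeH ξ ^ (2 * n + 4) = (hh ξ)⁻¹ * NN ξ := by
  rw [pow_add, gauge_pow_two_n h, gauge_pow_four]

lemma hh_pos {ξ : H n} (h : ξ ≠ 0) : 0 < hh ξ := Real.rpow_pos_of_pos (NN_pos h) _

lemma hh_sq {ξ : H n} (h : ξ ≠ 0) : hh ξ * hh ξ = (NN ξ ^ n)⁻¹ := by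
  unfold hh
  rw [← Real.rpow_add (NN_pos h), ← Real.rpow_natCast, ← Real.rpow_neg (NN_nonneg ξ)]
  congr 1
  ring

lemma tilde_x (ξ : H n) (i : Fin n) :
    (tilde ξ).1 i = (ξ.1 i * ξ.2.2 + ξ.2.1 i * rsq ξ) / NN ξ := by
  simp only [tilde, gauge_pow_four]

lemma tilde_y (ξ : H n) (i : Fin n) :
    (tilde ξ).2.1 i = (ξ.2.1 i * ξ.2.2 - ξ.1 i * rsq ξ) / NN ξ := by
  simp only [tilde, gauge_pow_four]

lemma tilde_t (ξ : H n) : (tilde ξ).2.2 = -ξ.2.2 / NN ξ := by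
  simp only [tilde, gauge_pow_four]

lemma tilde_zero : tilde (0 : H n) = 0 := by
  ext i
  · simp [tilde_x]
  · simp [tilde_y]
  · simp [tilde_t]

lemma rsq_eq (ξ : H n) : ∑ i, ((ξ.1 i) ^ 2 + (ξ.2.1 i) ^ 2) = rsq ξ := by
  rw [Finset.sum_add_distrib]; rfl

lemma rsq_tilde (ξ : H n) : rsq (tilde ξ) = rsq ξ / NN ξ := by
  by_cases h : ξ = 0
  · subst h; simp [rsq, tilde]
  have hN := (NN_pos h).ne'
  rw [← rsq_eq (tilde ξ)]
  simp only [tilde_x, tilde_y]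
  have : ∀ i, ((ξ.1 i * ξ.2.2 + ξ.2.1 i * rsq ξ) / NN ξ) ^ 2 +
    ((ξ.2.1 i * ξ.2.2 - ξ.1 i * rsq ξ) / NN ξ) ^ 2 =
      ((ξ.1 i) ^ 2 + (ξ.2.1 i) ^ 2) * (1 / NN ξ) := by
    intro i
    field_simp
    unfold NN
    ring
  simp only [this]
  rw [← Finset.sum_mul, rsq_eq]
  ring

lemma NN_tilde (ξ : H n) : NN (tilde ξ) = (NN ξ)⁻¹ := by
  by_cases h : ξ = 0
  · subst h
    have : tilde (0 : H n) = 0 := by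
      ext i
      · simp [tilde_x]
      · simp [tilde_y]
      · simp [tilde_t]
    rw [this]
    simp [NN_eq_zero.2]
  have hN := (NN_pos h).ne'
  have : NN (tilde ξ) = ((rsq ξ) ^ 2 + (ξ.2.2) ^ 2) / NN ξ ^ 2 := by
    rw [NN, rsq_tilde, tilde_t]; field_simp
  rw [this]
  change NN ξ / NN ξ ^ 2 = _
  field_simp

lemma tilde_ne {ξ : H n} (h : ξ ≠ 0) : tilde ξ ≠ 0 := by
  intro h'
  have := NN_tilde ξ
  rw [h', NN_eq_zero.2 rfl] at this
  exact (inv_pos.2 (NN_pos h)).ne this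

lemma hh_tilde {ξ : H n} (h : ξ ≠ 0) : hh (tilde ξ) = (hh ξ)⁻¹ := by
  unfold hh
  rw [NN_tilde, Real.inv_rpow (NN_nonneg ξ)]

/-- the sign change in the horizontal variables -/
def sg (ξ : H n) : H n := (-ξ.1, -ξ.2.1, ξ.2.2)

lemma sg_ne {ξ : H n} (h : ξ ≠ 0) : sg ξ ≠ 0 := by
  contrapose! h
  simp only [sg, Prod.ext_iff, Prod.fst_zero, Prod.snd_zero, neg_eq_zero] at h ⊢
  exact h

lemma sg_sg (ξ : H n) : sg (sg ξ) = ξ := by simp [sg]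

lemma tilde_tilde (ξ : H n) : tilde (tilde ξ) = sg ξ := by
  by_cases h : ξ = 0
  · subst h
    rw [tilde_zero, tilde_zero]
    simp [sg]; rfl
  have hN := (NN_pos h).ne'
  ext i
  · rw [tilde_x, tilde_x, tilde_y, tilde_t, rsq_tilde, NN_tilde]
    simp only [sg, Pi.neg_apply]
    field_simp
    unfold NN
    ring
  · rw [tilde_y, tilde_x, tilde_y, tilde_t, rsq_tilde, NN_tilde]
    simp only [sg, Pi.neg_apply]
    field_simp
    unfold NN
    ring
  · rw [tilde_t, tilde_t, NN_tilde]
    simp only [sg]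
    field_simp

/-- inverse of `tilde` -/
def stil (ξ : H n) : H n := sg (tilde ξ)

lemma rsq_sg (ξ : H n) : rsq (sg ξ) = rsq ξ := by simp [rsq, sg]
lemma NN_sg (ξ : H n) : NN (sg ξ) = NN ξ := by unfold NN; rw [rsq_sg]; rfl

lemma tilde_sg (ξ : H n) : tilde (sg ξ) = sg (tilde ξ) := by
  ext i
  · simp only [tilde_x, sg, Pi.neg_apply]
    rw [show NN (-ξ.1, -ξ.2.1, ξ.2.2) = NN ξ from NN_sg ξ,
      show rsq (-ξ.1, -ξ.2.1, ξ.2.2) = rsq ξ from rsq_sg ξ]; ring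
  · simp only [tilde_y, sg, Pi.neg_apply]
    rw [show NN (-ξ.1, -ξ.2.1, ξ.2.2) = NN ξ from NN_sg ξ,
      show rsq (-ξ.1, -ξ.2.1, ξ.2.2) = rsq ξ from rsq_sg ξ]; ring
  · simp only [tilde_t, sg]
    rw [show NN (-ξ.1, -ξ.2.1, ξ.2.2) = NN ξ from NN_sg ξ]

lemma tilde_stil (ξ : H n) : tilde (stil ξ) = ξ := by
  rw [stil, tilde_sg, tilde_tilde, sg_sg]

lemma stil_tilde (ξ : H n) : stil (tilde ξ) = ξ := by
  rw [stil, tilde_tilde, sg_sg]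

lemma stil_ne {ξ : H n} (h : ξ ≠ 0) : stil ξ ≠ 0 := sg_ne (tilde_ne h)

lemma tilde_inj : Function.Injective (tilde : H n → H n) :=
  Function.LeftInverse.injective stil_tilde

/-! ### smoothness -/

lemma contDiff_rsq {k} : ContDiff ℝ k (rsq : H n → ℝ) := by
  unfold rsq; fun_prop

lemma contDiff_NN {k} : ContDiff ℝ k (NN : H n → ℝ) := by
  unfold NN
  exact (contDiff_rsq.pow 2).add (by fun_prop)

lemma contDiffAt_hh {k} {ξ : H n} (h : ξ ≠ 0) : ContDiffAt ℝ k (hh : H n → ℝ) ξ := by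
  unfold hh
  exact contDiff_NN.contDiffAt.rpow_const_of_ne (NN_pos h).ne'

lemma contDiffAt_tilde {k} {ξ : H n} (h : ξ ≠ 0) : ContDiffAt ℝ k (tilde : H n → H n) ξ := by
  have hN := (NN_pos h).ne'
  have e : (tilde : H n → H n) = fun ξ =>
    (fun i => (ξ.1 i * ξ.2.2 + ξ.2.1 i * rsq ξ) / NN ξ,
     fun i => (ξ.2.1 i * ξ.2.2 - ξ.1 i * rsq ξ) / NN ξ, -ξ.2.2 / NN ξ) := by
    funext ξ; simp only [tilde, gauge_pow_four]
  rw [e]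
  have hR : ContDiffAt ℝ k (rsq : H n → ℝ) ξ := contDiff_rsq.contDiffAt
  have hNN : ContDiffAt ℝ k (NN : H n → ℝ) ξ := contDiff_NN.contDiffAt
  refine ContDiffAt.prodMk ?_ (ContDiffAt.prodMk ?_ ?_)
  · refine contDiffAt_pi.2 fun i => ContDiffAt.div ?_ hNN hN
    fun_prop
  · refine contDiffAt_pi.2 fun i => ContDiffAt.div ?_ hNN hN
    fun_prop
  · exact ContDiffAt.div (by fun_prop) hNN hN

lemma contDiff_sg {k} : ContDiff ℝ k (sg : H n → H n) := by
  unfold sg; fun_prop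

lemma contDiffAt_stil {k} {ξ : H n} (h : ξ ≠ 0) : ContDiffAt ℝ k (stil : H n → H n) ξ :=
  contDiff_sg.contDiffAt.comp ξ (contDiffAt_tilde h)

end Heisenberg

namespace Heisenberg
variable {n : ℕ}
set_option linter.unusedVariables false
set_option linter.unusedSimpArgs false

/-- `Σ (x p + y q)` -/
def mm (ξ : H n) (v : V n) : ℝ := ∑ i, (ξ.1 i * v.1 i + ξ.2.1 i * v.2 i)
/-- `Σ (y p - x q)` -/
def kk (ξ : H n) (v : V n) : ℝ := ∑ i, (ξ.2.1 i * v.1 i - ξ.1 i * v.2 i)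

def kap (ξ : H n) : ℝ := -4 * ξ.2.2 * rsq ξ / NN ξ ^ 2
def lam (ξ : H n) : ℝ := -2 * (ξ.2.2 ^ 2 - rsq ξ ^ 2) / NN ξ ^ 2

/-- The horizontal differential of `tilde` -/
def Ah (ξ : H n) (v : V n) : V n :=
  (fun j => (ξ.2.2 * v.1 j + rsq ξ * v.2 j) / NN ξ
      + kap ξ * (ξ.1 j * mm ξ v + ξ.2.1 j * kk ξ v)
      - lam ξ * (ξ.2.1 j * mm ξ v - ξ.1 j * kk ξ v),
   fun j => (ξ.2.2 * v.2 j - rsq ξ * v.1 j) / NN ξ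
      + kap ξ * (ξ.2.1 j * mm ξ v - ξ.1 j * kk ξ v)
      + lam ξ * (ξ.1 j * mm ξ v + ξ.2.1 j * kk ξ v))

/-- Its transpose -/
def AT (ξ : H n) (v : V n) : V n :=
  (fun j => (ξ.2.2 * v.1 j - rsq ξ * v.2 j) / NN ξ
      + kap ξ * (ξ.1 j * mm ξ v + ξ.2.1 j * kk ξ v)
      + lam ξ * (ξ.2.1 j * mm ξ v - ξ.1 j * kk ξ v),
   fun j => (ξ.2.2 * v.2 j + rsq ξ * v.1 j) / NN ξ
      + kap ξ * (ξ.2.1 j * mm ξ v - ξ.1 j * kk ξ v)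
      - lam ξ * (ξ.1 j * mm ξ v + ξ.2.1 j * kk ξ v))

lemma hdot_eq (a b : V n) : hdot a b = ∑ i, (a.1 i * b.1 i + a.2 i * b.2 i) := by
  rw [Finset.sum_add_distrib]; rfl

lemma hdot_comm (a b : V n) : hdot a b = hdot b a := by
  simp only [hdot, mul_comm]

lemma hdot_Ah (ξ : H n) (v w : V n) : hdot (Ah ξ v) w = hdot v (AT ξ w) := by
  have h1 : hdot (Ah ξ v) w = ξ.2.2 / NN ξ * hdot v w +
      (rsq ξ / NN ξ) * (∑ i, (v.2 i * w.1 i - v.1 i * w.2 i))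
      + (kap ξ * mm ξ v + lam ξ * kk ξ v) * mm ξ w
      + (kap ξ * kk ξ v - lam ξ * mm ξ v) * kk ξ w := by
    simp only [hdot_eq, Ah]
    generalize mm ξ v = M
    generalize kk ξ v = K
    simp only [mm, kk, Finset.mul_sum, ← Finset.sum_add_distrib]
    refine Finset.sum_congr rfl fun i _ => ?_
    ring
  have h2 : hdot v (AT ξ w) = ξ.2.2 / NN ξ * hdot v w +
      (rsq ξ / NN ξ) * (∑ i, (v.2 i * w.1 i - v.1 i * w.2 i))
      + (kap ξ * mm ξ w - lam ξ * kk ξ w) * mm ξ v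
      + (kap ξ * kk ξ w + lam ξ * mm ξ w) * kk ξ v := by
    simp only [hdot_eq, AT]
    generalize mm ξ w = M
    generalize kk ξ w = K
    simp only [mm, kk, Finset.mul_sum, ← Finset.sum_add_distrib]
    refine Finset.sum_congr rfl fun i _ => ?_
    ring
  rw [h1, h2]
  ring

lemma mm_AT (ξ : H n) (w : V n) :
    mm ξ (AT ξ w) = (ξ.2.2 / NN ξ + kap ξ * rsq ξ) * mm ξ w +
      (rsq ξ / NN ξ - lam ξ * rsq ξ) * kk ξ w := by
  have : mm ξ (AT ξ w) = ξ.2.2 / NN ξ * mm ξ w + rsq ξ / NN ξ * kk ξ w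
      + (kap ξ * mm ξ w - lam ξ * kk ξ w) * ∑ i, ((ξ.1 i) ^ 2 + (ξ.2.1 i) ^ 2) := by
    rw [mm]
    simp only [AT]
    generalize hM : mm ξ w = M
    generalize hK : kk ξ w = K
    conv_rhs => rw [← hM, ← hK]
    conv_rhs => enter [2]; rw [hM, hK]
    simp only [mm, kk, Finset.mul_sum, ← Finset.sum_add_distrib]
    refine Finset.sum_congr rfl fun i _ => ?_
    ring
  rw [this, rsq_eq]
  ring

lemma kk_AT (ξ : H n) (w : V n) :
    kk ξ (AT ξ w) = (ξ.2.2 / NN ξ + kap ξ * rsq ξ) * kk ξ w -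
      (rsq ξ / NN ξ - lam ξ * rsq ξ) * mm ξ w := by
  have : kk ξ (AT ξ w) = ξ.2.2 / NN ξ * kk ξ w + (- (rsq ξ / NN ξ)) * mm ξ w
      + (kap ξ * kk ξ w + lam ξ * mm ξ w) * ∑ i, ((ξ.1 i) ^ 2 + (ξ.2.1 i) ^ 2) := by
    rw [kk]
    simp only [AT]
    generalize hM : mm ξ w = M
    generalize hK : kk ξ w = K
    conv_rhs => rw [← hM, ← hK]
    conv_rhs => enter [2]; rw [hM, hK]
    simp only [mm, kk, Finset.mul_sum, ← Finset.sum_add_distrib]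
    refine Finset.sum_congr rfl fun i _ => ?_
    ring
  rw [this, rsq_eq]
  ring

lemma Ah_AT {ξ : H n} (h : ξ ≠ 0) (w : V n) : Ah ξ (AT ξ w) = (NN ξ)⁻¹ • w := by
  have hN := (NN_pos h).ne'
  have hN2 : rsq ξ ^ 2 = NN ξ - ξ.2.2 ^ 2 := by unfold NN; ring
  ext j
  · simp only [Ah, mm_AT, kk_AT]
    simp only [AT, kap, lam, Prod.smul_fst, Prod.smul_snd, Pi.smul_apply, smul_eq_mul]
    generalize mm ξ w = M
    generalize kk ξ w = K
    generalize rsq ξ = R at *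
    generalize NN ξ = N at *
    field_simp
    have hN3 : N = R ^ 2 + ξ.2.2 ^ 2 := by linarith
    rw [hN3]
    ring
  · simp only [Ah, mm_AT, kk_AT]
    simp only [AT, kap, lam, Prod.smul_fst, Prod.smul_snd, Pi.smul_apply, smul_eq_mul]
    generalize mm ξ w = M
    generalize kk ξ w = K
    generalize rsq ξ = R at *
    generalize NN ξ = N at *
    field_simp
    have hN3 : N = R ^ 2 + ξ.2.2 ^ 2 := by linarith
    rw [hN3]
    ring

lemma hdot_smul_left (c : ℝ) (a b : V n) : hdot (c • a) b = c * hdot a b := by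
  simp only [hdot_eq, Finset.mul_sum]
  refine Finset.sum_congr rfl fun i _ => ?_
  simp; ring

lemma hdot_add_left (a a' b : V n) : hdot (a + a') b = hdot a b + hdot a' b := by
  simp only [hdot_eq, ← Finset.sum_add_distrib]
  refine Finset.sum_congr rfl fun i _ => ?_
  simp; ring

lemma hdot_smul_right (c : ℝ) (a b : V n) : hdot a (c • b) = c * hdot a b := by
  rw [hdot_comm, hdot_smul_left, hdot_comm]

lemma hdot_add_right (a b b' : V n) : hdot a (b + b') = hdot a b + hdot a b' := by
  rw [hdot_comm, hdot_add_left, hdot_comm, hdot_comm b']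

lemma hdot_AT {ξ : H n} (h : ξ ≠ 0) (v w : V n) :
    hdot (AT ξ v) (AT ξ w) = (NN ξ)⁻¹ * hdot v w := by
  rw [← hdot_Ah, Ah_AT h, hdot_smul_left]

/-! ### the differential of `tilde` -/

lemma fderiv_of_curve {E : Type*} [NormedAddCommGroup E] [NormedSpace ℝ E]
    {f : H n → E} {ξ v : H n} {d : E} (hf : DifferentiableAt ℝ f ξ)
    (hd : HasDerivAt (fun s : ℝ => f (ξ + s • v)) d 0) : fderiv ℝ f ξ v = d := by
  have h1 := hf.hasFDerivAt.hasLineDerivAt v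
  exact h1.unique hd

lemma curve_rsq (ξ v : H n) :
    HasDerivAt (fun s : ℝ => rsq (ξ + s • v)) (2 * mm ξ (v.1, v.2.1)) 0 := by
  have : ∀ s : ℝ, rsq (ξ + s • v) = rsq ξ + s * (2 * mm ξ (v.1, v.2.1)) + s ^ 2 * rsq v := by
    intro s
    rw [← rsq_eq, ← rsq_eq, ← rsq_eq, mm]
    simp only [Finset.mul_sum, ← Finset.sum_add_distrib]
    refine Finset.sum_congr rfl fun i _ => ?_
    simp; ring
  simp only [this]
  have h := ((((hasDerivAt_id (0:ℝ)).mul_const (2 * mm ξ (v.1, v.2.1))).const_add (rsq ξ)).add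
    (((hasDerivAt_id (0:ℝ)).pow 2).mul_const (rsq v)))
  refine h.congr_deriv ?_
  simp

lemma curve_t (ξ v : H n) : HasDerivAt (fun s : ℝ => (ξ + s • v).2.2) v.2.2 0 := by
  have h := ((hasDerivAt_id (0:ℝ)).mul_const v.2.2).const_add ξ.2.2
  simpa using h

lemma curve_x (ξ v : H n) (i : Fin n) : HasDerivAt (fun s : ℝ => (ξ + s • v).1 i) (v.1 i) 0 := by
  have h := ((hasDerivAt_id (0:ℝ)).mul_const (v.1 i)).const_add (ξ.1 i)
  simpa using h

lemma curve_y (ξ v : H n) (i : Fin n) :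
    HasDerivAt (fun s : ℝ => (ξ + s • v).2.1 i) (v.2.1 i) 0 := by
  have h := ((hasDerivAt_id (0:ℝ)).mul_const (v.2.1 i)).const_add (ξ.2.1 i)
  simpa using h

lemma curve_NN (ξ v : H n) : HasDerivAt (fun s : ℝ => NN (ξ + s • v))
    (4 * rsq ξ * mm ξ (v.1, v.2.1) + 2 * ξ.2.2 * v.2.2) 0 := by
  have h := ((curve_rsq ξ v).pow 2).add ((curve_t ξ v).pow 2)
  refine h.congr_deriv ?_
  simp; ring

/-- the differential of `tilde`, explicitly -/
def LT (ξ v : H n) : H n :=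
  (fun j => ((v.1 j * ξ.2.2 + ξ.1 j * v.2.2 + (v.2.1 j * rsq ξ
        + ξ.2.1 j * (2 * mm ξ (v.1, v.2.1)))) * NN ξ
      - (ξ.1 j * ξ.2.2 + ξ.2.1 j * rsq ξ) *
        (4 * rsq ξ * mm ξ (v.1, v.2.1) + 2 * ξ.2.2 * v.2.2)) / NN ξ ^ 2,
   fun j => ((v.2.1 j * ξ.2.2 + ξ.2.1 j * v.2.2 - (v.1 j * rsq ξ
        + ξ.1 j * (2 * mm ξ (v.1, v.2.1)))) * NN ξ
      - (ξ.2.1 j * ξ.2.2 - ξ.1 j * rsq ξ) *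
        (4 * rsq ξ * mm ξ (v.1, v.2.1) + 2 * ξ.2.2 * v.2.2)) / NN ξ ^ 2,
   (-v.2.2 * NN ξ - -ξ.2.2 *
        (4 * rsq ξ * mm ξ (v.1, v.2.1) + 2 * ξ.2.2 * v.2.2)) / NN ξ ^ 2)

lemma fderiv_tilde {ξ : H n} (h : ξ ≠ 0) (v : H n) : fderiv ℝ tilde ξ v = LT ξ v := by
  have hN := (NN_pos h).ne'
  apply fderiv_of_curve ((contDiffAt_tilde (k := 1) h).differentiableAt (by simp))
  have hN' : NN (ξ + (0:ℝ) • v) ≠ 0 := by simpa using hN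
  refine HasDerivAt.prodMk (hasDerivAt_pi.2 fun j => ?_)
    (HasDerivAt.prodMk (hasDerivAt_pi.2 fun j => ?_) ?_)
  · have := (((curve_x ξ v j).mul (curve_t ξ v)).add
      ((curve_y ξ v j).mul (curve_rsq ξ v))).div (curve_NN ξ v) hN'
    simp only [gauge_pow_four]
    refine this.congr_deriv ?_
    simp
  · have := (((curve_y ξ v j).mul (curve_t ξ v)).sub
      ((curve_x ξ v j).mul (curve_rsq ξ v))).div (curve_NN ξ v) hN'
    simp only [gauge_pow_four]
    refine this.congr_deriv ?_
    simp
  · have := (curve_t ξ v).neg.div (curve_NN ξ v) hN'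
    simp only [gauge_pow_four]
    refine this.congr_deriv ?_
    simp

/-- horizontal lift -/
def lift (ξ : H n) (v : V n) : H n := (v.1, v.2, 2 * kk ξ v)

lemma mm_eta (ξ : H n) (v : V n) : mm ξ (v.1, v.2) = mm ξ v := rfl

lemma LT_lift_fst {ξ : H n} (h : ξ ≠ 0) (v : V n) : (LT ξ (lift ξ v)).1 = (Ah ξ v).1 := by
  have hN := (NN_pos h).ne'
  have hN2 : NN ξ = rsq ξ ^ 2 + ξ.2.2 ^ 2 := rfl
  ext j
  simp only [LT, lift, Ah, kap, lam, mm_eta]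
  generalize mm ξ v = M at *
  generalize rsq ξ = R at *
  generalize NN ξ = N at *
  generalize kk ξ v = K at *
  field_simp
  rw [hN2]
  ring

lemma LT_lift_snd {ξ : H n} (h : ξ ≠ 0) (v : V n) : (LT ξ (lift ξ v)).2.1 = (Ah ξ v).2 := by
  have hN := (NN_pos h).ne'
  have hN2 : NN ξ = rsq ξ ^ 2 + ξ.2.2 ^ 2 := rfl
  ext j
  simp only [LT, lift, Ah, kap, lam, mm_eta]
  generalize mm ξ v = M at *
  generalize rsq ξ = R at *
  generalize NN ξ = N at *
  generalize kk ξ v = K at *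
  field_simp
  rw [hN2]
  ring

/-- `tilde` is a contact map -/
lemma LT_contact {ξ : H n} (h : ξ ≠ 0) (v : H n) :
    (LT ξ v).2.2 = 2 * kk (tilde ξ) ((LT ξ v).1, (LT ξ v).2.1) +
      (v.2.2 - 2 * kk ξ (v.1, v.2.1)) / NN ξ := by
  have hN := (NN_pos h).ne'
  have hN2 : NN ξ = rsq ξ ^ 2 + ξ.2.2 ^ 2 := rfl
  have e : kk (tilde ξ) ((LT ξ v).1, (LT ξ v).2.1) =
     (ξ.2.2 ^ 2 + rsq ξ ^ 2) / NN ξ ^ 2 * kk ξ (v.1, v.2.1) +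
     (- rsq ξ * v.2.2 / NN ξ ^ 2 + 2 * ξ.2.2 * mm ξ (v.1, v.2.1) / NN ξ ^ 2) *
       ∑ i, ((ξ.1 i) ^ 2 + (ξ.2.1 i) ^ 2) := by
    rw [kk]
    simp only [tilde_x, tilde_y, LT]
    generalize hM : mm ξ (v.1, v.2.1) = M
    generalize rsq ξ = R at *
    generalize NN ξ = N at *
    simp only [kk, Finset.mul_sum, ← Finset.sum_add_distrib]
    refine Finset.sum_congr rfl fun i _ => ?_
    field_simp
    rw [hN2]
    ring
  rw [e, rsq_eq]
  simp only [LT]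
  generalize mm ξ (v.1, v.2.1) = M
  generalize kk ξ (v.1, v.2.1) = K
  generalize rsq ξ = R at *
  generalize NN ξ = N at *
  field_simp
  rw [hN2]
  ring

lemma LT_lift {ξ : H n} (h : ξ ≠ 0) (v : V n) :
    LT ξ (lift ξ v) = lift (tilde ξ) (Ah ξ v) := by
  have h1 := LT_lift_fst h v
  have h2 := LT_lift_snd h v
  refine Prod.ext h1 (Prod.ext h2 ?_)
  rw [LT_contact h, h1, h2]
  simp only [lift]
  change _ + (2 * kk ξ v - 2 * kk ξ v) / _ = _
  simp

lemma fderiv_lift (φ : H n → ℝ) (ξ : H n) (v : V n) :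
    fderiv ℝ φ ξ (lift ξ v) = hdot v (hGrad φ ξ) := by
  have : lift ξ v = ∑ i, (v.1 i • ((Pi.single i 1, 0, 2 * ξ.2.1 i) : H n)
      + v.2 i • ((0, Pi.single i 1, -(2 * ξ.1 i)) : H n)) := by
    refine Prod.ext ?_ (Prod.ext ?_ ?_)
    · simp only [lift, Prod.fst_sum, Prod.fst_add, Prod.smul_fst]
      ext j
      simp [Finset.sum_apply, Pi.single_apply]
    · simp only [lift, Prod.fst_sum, Prod.snd_sum, Prod.fst_add, Prod.snd_add, Prod.smul_fst,
        Prod.smul_snd]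
      ext j
      simp [Finset.sum_apply, Pi.single_apply]
    · simp only [lift, Prod.snd_sum, Prod.snd_add,
        Prod.smul_snd, kk, Finset.mul_sum]
      refine Finset.sum_congr rfl fun i _ => ?_
      simp; ring
  rw [this, map_sum, hdot_eq]
  refine Finset.sum_congr rfl fun i _ => ?_
  rw [map_add, map_smul, map_smul]
  rfl

lemma hdot_ext {a b : V n} (h : ∀ v, hdot v a = hdot v b) : a = b := by
  ext i
  · simpa [hdot, Pi.single_apply] using h (Pi.single i 1, 0)
  · simpa [hdot, Pi.single_apply] using h (0, Pi.single i 1)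

lemma hGrad_comp_tilde {φ : H n → ℝ} {ξ : H n} (h : ξ ≠ 0)
    (hφ : DifferentiableAt ℝ φ (tilde ξ)) :
    hGrad (fun ξ => φ (tilde ξ)) ξ = AT ξ (hGrad φ (tilde ξ)) := by
  apply hdot_ext
  intro v
  rw [← fderiv_lift, ← hdot_Ah, ← fderiv_lift, ← LT_lift h, ← fderiv_tilde h]
  have := fderiv_comp (x := ξ) hφ ((contDiffAt_tilde (k := 1) h).differentiableAt (by simp))
  exact congrArg (fun L => L (lift ξ v)) this

/-! ### the Jacobian -/

/-- shear -/
def th (ξ : H n) : H n →ₗ[ℝ] ℝ where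
  toFun v := 2 * kk ξ (v.1, v.2.1)
  map_add' a b := by
    simp only [kk, Finset.mul_sum, ← Finset.sum_add_distrib]
    refine Finset.sum_congr rfl fun i _ => ?_
    simp; ring
  map_smul' c a := by
    simp only [kk, Finset.mul_sum, smul_eq_mul, RingHom.id_apply]
    refine Finset.sum_congr rfl fun i _ => ?_
    simp; ring

lemma mm_add (ξ : H n) (a b : V n) : mm ξ (a + b) = mm ξ a + mm ξ b := by
  simp only [mm, ← Finset.sum_add_distrib]
  refine Finset.sum_congr rfl fun i _ => ?_
  simp; ring
lemma kk_add (ξ : H n) (a b : V n) : kk ξ (a + b) = kk ξ a + kk ξ b := by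
  simp only [kk, ← Finset.sum_add_distrib]
  refine Finset.sum_congr rfl fun i _ => ?_
  simp; ring
lemma mm_smul (ξ : H n) (c : ℝ) (b : V n) : mm ξ (c • b) = c * mm ξ b := by
  simp only [mm, Finset.mul_sum]
  refine Finset.sum_congr rfl fun i _ => ?_
  simp; ring
lemma kk_smul (ξ : H n) (c : ℝ) (b : V n) : kk ξ (c • b) = c * kk ξ b := by
  simp only [kk, Finset.mul_sum]
  refine Finset.sum_congr rfl fun i _ => ?_
  simp; ring

/-- `Ah` as a linear map -/
def AhL (ξ : H n) : V n →ₗ[ℝ] V n where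
  toFun := Ah ξ
  map_add' a b := by
    ext j <;> simp [Ah, mm_add, kk_add] <;> ring
  map_smul' c a := by
    ext j <;> simp [Ah, mm_smul, kk_smul] <;> ring

/-- `AT` as a linear map -/
def ATL (ξ : H n) : V n →ₗ[ℝ] V n where
  toFun := AT ξ
  map_add' a b := by
    ext j <;> simp [AT, mm_add, kk_add] <;> ring
  map_smul' c a := by
    ext j <;> simp [AT, mm_smul, kk_smul] <;> ring

end Heisenberg

namespace Heisenberg
variable {n : ℕ}
set_option linter.unusedVariables false
set_option linter.unusedSimpArgs false

/-- the pairing as a map to the dual -/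
def dotDual (n : ℕ) : V n →ₗ[ℝ] Module.Dual ℝ (V n) :=
  LinearMap.mk₂ ℝ hdot (fun a a' b => hdot_add_left a a' b) (fun c a b => hdot_smul_left c a b)
    (fun a b b' => hdot_add_right a b b') (fun c a b => hdot_smul_right c a b)

lemma det_Ah {ξ : H n} (h : ξ ≠ 0) : |LinearMap.det (AhL ξ)| = (NN ξ ^ n)⁻¹ := by
  have hN := NN_pos h
  have hinj : Function.Injective (dotDual n) := by
    intro a b hab
    apply hdot_ext
    intro v
    rw [hdot_comm v a, hdot_comm v b]
    exact congrArg (fun L => L v) hab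
  let e := (dotDual n).linearEquivOfInjective hinj (Subspace.dual_finrank_eq).symm
  have he : ∀ a b, e a b = hdot a b := fun a b => rfl
  have h1 : (AhL ξ).dualMap = (e : V n →ₗ[ℝ] _) ∘ₗ ATL ξ ∘ₗ (e.symm : _ →ₗ[ℝ] V n) := by
    ext1 g
    obtain ⟨a, rfl⟩ := e.surjective g
    refine LinearMap.ext fun v => ?_
    simp only [LinearMap.dualMap_apply, LinearMap.comp_apply, LinearEquiv.coe_coe,
      LinearEquiv.symm_apply_apply]
    rw [he, he]
    change hdot a (Ah ξ v) = hdot (AT ξ a) v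
    rw [hdot_comm, hdot_Ah, hdot_comm]
  have h2 : LinearMap.det (AhL ξ) = LinearMap.det (ATL ξ) := by
    rw [← LinearMap.det_dualMap, h1, LinearMap.det_conj]
  have h3 : AhL ξ ∘ₗ ATL ξ = (NN ξ)⁻¹ • LinearMap.id := by
    refine LinearMap.ext fun v => ?_
    exact Ah_AT h v
  have h4 : LinearMap.det (AhL ξ) * LinearMap.det (ATL ξ) = ((NN ξ)⁻¹) ^ (n + n) := by
    rw [← LinearMap.det_comp, h3, LinearMap.det_smul]
    simp
  rw [← h2] at h4
  have h5 : |LinearMap.det (AhL ξ)| ^ 2 = ((NN ξ ^ n)⁻¹) ^ 2 := by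
    rw [sq_abs, sq, h4]
    rw [pow_add, inv_pow, sq]
  exact (pow_left_inj₀ (abs_nonneg _) (by positivity) (by norm_num)).1 h5

lemma det_fderiv_tilde {ξ : H n} (h : ξ ≠ 0) :
    |(fderiv ℝ tilde ξ).det| = (NN ξ ^ (n + 1))⁻¹ := by
  have hN := NN_pos h
  let L : H n →ₗ[ℝ] H n := (fderiv ℝ tilde ξ : H n →L[ℝ] H n)
  have hL : ∀ v, L v = LT ξ v := fun v => fderiv_tilde h v
  let c : V n := ((L (0, 0, 1)).1, (L (0, 0, 1)).2.1)
  let w : V n := NN ξ • AT ξ c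
  have hw : Ah ξ w = c := by
    have : Ah ξ w = NN ξ • Ah ξ (AT ξ c) := (AhL ξ).map_smul (NN ξ) (AT ξ c)
    rw [this, Ah_AT h, smul_smul, mul_inv_cancel₀ hN.ne', one_smul]
  let tt : H n →ₗ[ℝ] ℝ := LinearMap.snd ℝ _ _ ∘ₗ LinearMap.snd ℝ _ _
  let E1 := LinearMap.transvection (th ξ) ((0, 0, 1) : H n)
  let E2 := LinearMap.transvection (th (tilde ξ)) ((0, 0, 1) : H n)
  let Sh := LinearMap.transvection tt ((w.1, w.2, 0) : H n)
  let a := LinearEquiv.prodAssoc ℝ (Fin n → ℝ) (Fin n → ℝ) ℝ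
  let P : H n →ₗ[ℝ] H n := (a : _ →ₗ[ℝ] H n) ∘ₗ
    (LinearMap.prodMap (AhL ξ) ((NN ξ)⁻¹ • (LinearMap.id : ℝ →ₗ[ℝ] ℝ))) ∘ₗ
      (a.symm : H n →ₗ[ℝ] (V n × ℝ))
  have d1 : LinearMap.det E1 = 1 := by
    rw [LinearMap.transvection.det]
    simp [th, kk]
  have d2 : LinearMap.det E2 = 1 := by
    rw [LinearMap.transvection.det]
    simp [th, kk]
  have d3 : LinearMap.det Sh = 1 := by
    rw [LinearMap.transvection.det]
    simp [tt]
  have d4 : LinearMap.det P = LinearMap.det (AhL ξ) * (NN ξ)⁻¹ := by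
    rw [LinearMap.det_conj, LinearMap.det_prodMap, LinearMap.det_smul]
    simp
  have key : L ∘ₗ E1 = E2 ∘ₗ P ∘ₗ Sh := by
    refine LinearMap.ext fun v => ?_
    have e1 : E1 v = lift ξ (v.1, v.2.1) + v.2.2 • ((0, 0, 1) : H n) := by
      refine Prod.ext ?_ (Prod.ext ?_ ?_)
      · simp [E1, LinearMap.transvection.apply, lift]
      · simp [E1, LinearMap.transvection.apply, lift]
      · simp [E1, LinearMap.transvection.apply, lift, th, add_comm]
    have e2 : P (Sh v) = ((Ah ξ (v.1, v.2.1)).1 + v.2.2 • c.1,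
        (Ah ξ (v.1, v.2.1)).2 + v.2.2 • c.2, v.2.2 / NN ξ) := by
      have : Ah ξ ((v.1, v.2.1) + v.2.2 • w) = Ah ξ (v.1, v.2.1) + v.2.2 • c := by
        rw [← hw]
        exact ((AhL ξ).map_add _ _).trans (congrArg _ ((AhL ξ).map_smul _ _))
      have hP : P (Sh v) = ((Ah ξ ((v.1, v.2.1) + v.2.2 • w)).1,
        (Ah ξ ((v.1, v.2.1) + v.2.2 • w)).2, (NN ξ)⁻¹ * (v.2.2 + v.2.2 * 0)) := rfl
      rw [hP, this]
      simp [div_eq_inv_mul]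
    have e3 : L (lift ξ (v.1, v.2.1)) = lift (tilde ξ) (Ah ξ (v.1, v.2.1)) := by
      rw [hL, LT_lift h]
    have e4 : L (0, 0, 1) = (c.1, c.2, 2 * kk (tilde ξ) c + 1 / NN ξ) := by
      refine Prod.ext rfl (Prod.ext rfl ?_)
      have := LT_contact h (0, 0, 1)
      rw [← hL] at this
      rw [this]
      simp [kk, c]
    rw [LinearMap.comp_apply, e1, map_add, map_smul, e3, e4, LinearMap.comp_apply,
      LinearMap.comp_apply, e2]
    refine Prod.ext ?_ (Prod.ext ?_ ?_)
    · simp [E2, LinearMap.transvection.apply, lift]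
    · simp [E2, LinearMap.transvection.apply, lift]
    · have : kk (tilde ξ) ((Ah ξ (v.1, v.2.1)).1 + v.2.2 • c.1,
        (Ah ξ (v.1, v.2.1)).2 + v.2.2 • c.2) = kk (tilde ξ) (Ah ξ (v.1, v.2.1)) +
          v.2.2 * kk (tilde ξ) c := by
        rw [← kk_smul, ← kk_add]; rfl
      simp only [E2, LinearMap.transvection.apply, lift, th, LinearMap.coe_mk, AddHom.coe_mk,
        this]
      simp
      ring
  have k2 := congrArg LinearMap.det key
  rw [LinearMap.det_comp, LinearMap.det_comp, LinearMap.det_comp, d1, d2, d3, d4] at k2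
  have k3 : (fderiv ℝ tilde ξ).det = LinearMap.det (AhL ξ) * (NN ξ)⁻¹ := by
    simpa using k2
  rw [k3, abs_mul, det_Ah h, abs_of_pos (inv_pos.2 hN), pow_succ, mul_inv]

/-! ### change of variables -/

lemma tilde_image_compl : tilde '' ({(0 : H n)}ᶜ) = {0}ᶜ := by
  ext ξ
  constructor
  · rintro ⟨η, hη, rfl⟩
    exact tilde_ne hη
  · intro h
    exact ⟨stil ξ, stil_ne h, tilde_stil ξ⟩

lemma hasFDeriv_tilde {ξ : H n} (h : ξ ≠ 0) (s : Set (H n)) :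
    HasFDerivWithinAt tilde (fderiv ℝ tilde ξ) s ξ :=
  (((contDiffAt_tilde (k := 1) h).differentiableAt (by simp)).hasFDerivAt).hasFDerivWithinAt

instance instHaarYt (n : ℕ) : (volume : Measure ((Fin n → ℝ) × ℝ)).IsAddHaarMeasure :=
  inferInstanceAs ((volume : Measure (Fin n → ℝ)).prod (volume : Measure ℝ)).IsAddHaarMeasure

instance instHaarH (n : ℕ) : (volume : Measure (H n)).IsAddHaarMeasure :=
  Measure.prod.instIsAddHaarMeasure (volume : Measure (Fin n → ℝ))
    (volume : Measure ((Fin n → ℝ) × ℝ))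

lemma ae_ne_zero (hn : 1 ≤ n) : ∀ᵐ ξ : H n, ξ ≠ 0 := by
  rw [ae_iff]
  have : Nontrivial (H n) := ⟨⟨0, (0, 0, 1), fun h => by
    have := congrArg (fun z : H n => z.2.2) h
    simp at this⟩⟩
  have hb : (𝓝[≠] (0 : H n)).NeBot := Module.punctured_nhds_neBot ℝ (H n) 0
  have := Measure.IsAddHaarMeasure.nullSingletonClass (volume : Measure (H n))
  simpa using measure_singleton (μ := (volume : Measure (H n))) 0

lemma integral_tilde (hn : 1 ≤ n) (g : H n → ℝ) :
    ∫ ξ, g ξ = ∫ ξ, (NN ξ ^ (n + 1))⁻¹ * g (tilde ξ) := by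
  have hr : (volume : Measure (H n)).restrict {0}ᶜ = volume :=
    Measure.restrict_eq_self_of_ae_mem (ae_ne_zero hn)
  have := integral_image_eq_integral_abs_det_fderiv_smul (μ := (volume : Measure (H n)))
    (s := {0}ᶜ) (f := tilde) (f' := fun ξ => fderiv ℝ tilde ξ)
    (measurableSet_singleton 0).compl (fun x hx => hasFDeriv_tilde hx _)
    (tilde_inj.injOn) g
  rw [tilde_image_compl, hr] at this
  rw [this]
  refine integral_congr_ae ?_
  filter_upwards [ae_ne_zero hn] with ξ hξ
  rw [det_fderiv_tilde hξ, smul_eq_mul]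

lemma integrableOn_tilde {s : Set (H n)} (hs : MeasurableSet s) (h0 : s ⊆ {0}ᶜ) (g : H n → ℝ) :
    IntegrableOn g (tilde '' s) ↔ IntegrableOn (fun ξ => (NN ξ ^ (n + 1))⁻¹ * g (tilde ξ)) s := by
  rw [integrableOn_image_iff_integrableOn_abs_det_fderiv_smul (μ := (volume : Measure (H n)))
    (s := s) (f := tilde) (f' := fun ξ => fderiv ℝ tilde ξ)
    hs (fun x hx => hasFDeriv_tilde (h0 hx) _)
    (tilde_inj.injOn) g]
  refine integrableOn_congr_fun (fun ξ hξ => ?_) hs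
  rw [det_fderiv_tilde (h0 hξ), smul_eq_mul]

end Heisenberg

namespace Heisenberg
variable {n : ℕ}
set_option linter.unusedVariables false
set_option linter.unusedSimpArgs false

lemma IsTest.mono {Ω Ω' : Set (H n)} {φ : H n → ℝ} (h : IsTest Ω φ) (hs : Ω ⊆ Ω') :
    IsTest Ω' φ := ⟨h.contDiff, h.compactSupport, h.supportSubset.trans hs⟩

lemma IsTest.univ {Ω : Set (H n)} {φ : H n → ℝ} (h : IsTest Ω φ) : IsTest Set.univ φ :=
  h.mono (subset_univ _)

lemma IsTest.add {Ω : Set (H n)} {φ ψ : H n → ℝ} (h : IsTest Ω φ) (h' : IsTest Ω ψ) :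
    IsTest Ω (fun ξ => φ ξ + ψ ξ) :=
  ⟨h.contDiff.add h'.contDiff, h.compactSupport.add h'.compactSupport,
    (tsupport_add φ ψ).trans (union_subset h.supportSubset h'.supportSubset)⟩

lemma IsTest.const_mul {Ω : Set (H n)} {φ : H n → ℝ} (h : IsTest Ω φ) (c : ℝ) :
    IsTest Ω (fun ξ => c * φ ξ) :=
  ⟨contDiff_const.mul h.contDiff, h.compactSupport.mul_left (f := fun _ => c),
    (tsupport_mul_subset_right (f := fun _ => c) (g := φ)).trans h.supportSubset⟩

lemma IsTest.mulC {c ψ : H n → ℝ} (hψ : IsTest {0}ᶜ ψ) (hc : ∀ ξ ≠ 0, ContDiffAt ℝ 1 c ξ) :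
    IsTest {0}ᶜ (fun ξ => c ξ * ψ ξ) := by
  refine ⟨?_, hψ.compactSupport.mul_left (f := c),
    (tsupport_mul_subset_right (f := c) (g := ψ)).trans hψ.supportSubset⟩
  rw [contDiff_iff_contDiffAt]
  intro ξ
  by_cases h : ξ ∈ tsupport ψ
  · exact (hc ξ (hψ.supportSubset h)).mul hψ.contDiff.contDiffAt
  · have := notMem_tsupport_iff_eventuallyEq.1 h
    have h2 : (fun ξ => c ξ * ψ ξ) =ᶠ[𝓝 ξ] fun _ => 0 := by
      filter_upwards [this] with η hη
      simp [hη]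
    exact contDiffAt_const.congr_of_eventuallyEq h2

lemma IsTest.mulCont {Ω : Set (H n)} {c ψ : H n → ℝ} (hψ : IsTest Ω ψ) (hc : ContDiff ℝ 1 c) :
    IsTest Ω (fun ξ => c ξ * ψ ξ) :=
  ⟨hc.mul hψ.contDiff, hψ.compactSupport.mul_left (f := c),
    (tsupport_mul_subset_right (f := c) (g := ψ)).trans hψ.supportSubset⟩

lemma IsTest.compStil {φ : H n → ℝ} (hφ : IsTest {0}ᶜ φ) :
    IsTest {0}ᶜ (fun ξ => φ (stil ξ)) := by
  have hK : IsCompact (tilde '' (tsupport φ)) := by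
    refine hφ.compactSupport.isCompact.image_of_continuousOn ?_
    intro ξ hξ
    exact (contDiffAt_tilde (k := 1) (hφ.supportSubset hξ)).continuousAt.continuousWithinAt
  have hs : Function.support (fun ξ => φ (stil ξ)) ⊆ tilde '' (tsupport φ) := by
    intro ξ hξ
    exact ⟨stil ξ, subset_tsupport φ hξ, tilde_stil ξ⟩
  have hts : tsupport (fun ξ => φ (stil ξ)) ⊆ tilde '' (tsupport φ) :=
    closure_minimal hs hK.isClosed
  have h0 : tsupport (fun ξ => φ (stil ξ)) ⊆ {0}ᶜ := by
    refine hts.trans ?_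
    rintro _ ⟨ξ, hξ, rfl⟩
    exact tilde_ne (hφ.supportSubset hξ)
  refine ⟨?_, HasCompactSupport.of_support_subset_isCompact hK hs, h0⟩
  rw [contDiff_iff_contDiffAt]
  intro ξ
  by_cases h : ξ ∈ tsupport (fun ξ => φ (stil ξ))
  · exact hφ.contDiff.contDiffAt.comp ξ (contDiffAt_stil (h0 h))
  · have := notMem_tsupport_iff_eventuallyEq.1 h
    exact contDiffAt_const.congr_of_eventuallyEq this

/-! ### derivatives -/

lemma Xd_eq (i : Fin n) (φ : H n → ℝ) (ξ : H n) : Xd i φ ξ =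
    fderiv ℝ φ ξ (Pi.single i 1, 0, 0) + 2 * ξ.2.1 i * fderiv ℝ φ ξ (0, 0, 1) := by
  unfold Xd
  rw [← smul_eq_mul (2 * ξ.2.1 i), ← map_smul, ← map_add]
  simp

lemma Yd_eq (i : Fin n) (φ : H n → ℝ) (ξ : H n) : Yd i φ ξ =
    fderiv ℝ φ ξ (0, Pi.single i 1, 0) + (-(2 * ξ.1 i)) * fderiv ℝ φ ξ (0, 0, 1) := by
  unfold Yd
  rw [← smul_eq_mul (-(2 * ξ.1 i)), ← map_smul, ← map_add]
  simp

lemma cont_fderiv_apply {φ : H n → ℝ} (h : ContDiff ℝ 1 φ) (v : H n) :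
    Continuous (fun ξ => fderiv ℝ φ ξ v) :=
  (h.continuous_fderiv (by simp)).clm_apply continuous_const

lemma IsTest.Xd_cont {Ω : Set (H n)} {φ : H n → ℝ} (h : IsTest Ω φ) (i : Fin n) :
    Continuous (Xd i φ) := by
  have := cont_fderiv_apply h.contDiff
  have e : Xd i φ = _ := funext (Xd_eq i φ)
  rw [e]
  exact (this _).add ((by fun_prop : Continuous fun ξ : H n => 2 * ξ.2.1 i).mul (this _))

lemma IsTest.Yd_cont {Ω : Set (H n)} {φ : H n → ℝ} (h : IsTest Ω φ) (i : Fin n) :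
    Continuous (Yd i φ) := by
  have := cont_fderiv_apply h.contDiff
  have e : Yd i φ = _ := funext (Yd_eq i φ)
  rw [e]
  exact (this _).add ((by fun_prop : Continuous fun ξ : H n => -(2 * ξ.1 i)).mul (this _))

lemma hcs_of_zero {φ d : H n → ℝ} (h : HasCompactSupport φ)
    (hd : ∀ ξ, fderiv ℝ φ ξ = 0 → d ξ = 0) : HasCompactSupport d := by
  refine (h.fderiv (𝕜 := ℝ)).mono ?_
  intro ξ hξ h'
  exact hξ (hd ξ h')

lemma IsTest.Xd_hcs {Ω : Set (H n)} {φ : H n → ℝ} (h : IsTest Ω φ) (i : Fin n) :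
    HasCompactSupport (Xd i φ) := hcs_of_zero h.compactSupport fun ξ h => by simp [Xd, h]

lemma IsTest.Yd_hcs {Ω : Set (H n)} {φ : H n → ℝ} (h : IsTest Ω φ) (i : Fin n) :
    HasCompactSupport (Yd i φ) := hcs_of_zero h.compactSupport fun ξ h => by simp [Yd, h]

lemma Xd_mul (i : Fin n) {c ψ : H n → ℝ} {ξ : H n} (hc : DifferentiableAt ℝ c ξ)
    (hψ : DifferentiableAt ℝ ψ ξ) :
    Xd i (fun ξ => c ξ * ψ ξ) ξ = c ξ * Xd i ψ ξ + ψ ξ * Xd i c ξ := by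
  unfold Xd
  rw [fderiv_fun_mul hc hψ]; simp

lemma Yd_mul (i : Fin n) {c ψ : H n → ℝ} {ξ : H n} (hc : DifferentiableAt ℝ c ξ)
    (hψ : DifferentiableAt ℝ ψ ξ) :
    Yd i (fun ξ => c ξ * ψ ξ) ξ = c ξ * Yd i ψ ξ + ψ ξ * Yd i c ξ := by
  unfold Yd
  rw [fderiv_fun_mul hc hψ]; simp

lemma hGrad_mul {c ψ : H n → ℝ} {ξ : H n} (hc : DifferentiableAt ℝ c ξ)
    (hψ : DifferentiableAt ℝ ψ ξ) :
    hGrad (fun ξ => c ξ * ψ ξ) ξ = c ξ • hGrad ψ ξ + ψ ξ • hGrad c ξ := by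
  refine Prod.ext (funext fun i => ?_) (funext fun i => ?_)
  · exact Xd_mul i hc hψ
  · exact Yd_mul i hc hψ

lemma integral_Xd (i : Fin n) {Ω : Set (H n)} {φ : H n → ℝ} (h : IsTest Ω φ) :
    ∫ ξ, Xd i φ ξ = 0 := by
  have key : ∀ (a : H n → ℝ) (v : H n), ContDiff ℝ 1 a → (∀ ξ, fderiv ℝ a ξ v = 0) →
      Integrable (fun ξ => a ξ * fderiv ℝ φ ξ v) ∧ ∫ ξ, a ξ * fderiv ℝ φ ξ v = 0 := by
    intro a v ha hv
    have i1 : Integrable (fun ξ => a ξ * fderiv ℝ φ ξ v) := by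
      refine (ha.continuous.mul (cont_fderiv_apply h.contDiff v)).integrable_of_hasCompactSupport ?_
      exact hcs_of_zero h.compactSupport fun ξ h => by simp [h]
    refine ⟨i1, ?_⟩
    rw [integral_mul_fderiv_eq_neg_fderiv_mul_of_integrable]
    · simp [hv]
    · simp [hv]
    · exact i1
    · exact (ha.continuous.mul h.contDiff.continuous).integrable_of_hasCompactSupport
        (h.compactSupport.mul_left (f := a))
    · exact fun x _ => ha.differentiable (by simp) x
    · exact fun x _ => h.contDiff.differentiable (by simp) x
  have k1 := key (fun _ => 1) (Pi.single i 1, 0, 0) contDiff_const (by simp)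
  have k2 := key (fun ξ => 2 * ξ.2.1 i) (0, 0, 1) (by fun_prop) (by
    intro ξ
    refine fderiv_of_curve (by fun_prop) ?_
    simpa using (curve_y ξ (0, 0, 1) i).const_mul 2)
  simp only [one_mul] at k1
  simp only [Xd_eq]
  rw [integral_add k1.1 k2.1, k1.2, k2.2, add_zero]

lemma integral_Yd (i : Fin n) {Ω : Set (H n)} {φ : H n → ℝ} (h : IsTest Ω φ) :
    ∫ ξ, Yd i φ ξ = 0 := by
  have key : ∀ (a : H n → ℝ) (v : H n), ContDiff ℝ 1 a → (∀ ξ, fderiv ℝ a ξ v = 0) →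
      Integrable (fun ξ => a ξ * fderiv ℝ φ ξ v) ∧ ∫ ξ, a ξ * fderiv ℝ φ ξ v = 0 := by
    intro a v ha hv
    have i1 : Integrable (fun ξ => a ξ * fderiv ℝ φ ξ v) := by
      refine (ha.continuous.mul (cont_fderiv_apply h.contDiff v)).integrable_of_hasCompactSupport ?_
      exact hcs_of_zero h.compactSupport fun ξ h => by simp [h]
    refine ⟨i1, ?_⟩
    rw [integral_mul_fderiv_eq_neg_fderiv_mul_of_integrable]
    · simp [hv]
    · simp [hv]
    · exact i1
    · exact (ha.continuous.mul h.contDiff.continuous).integrable_of_hasCompactSupport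
        (h.compactSupport.mul_left (f := a))
    · exact fun x _ => ha.differentiable (by simp) x
    · exact fun x _ => h.contDiff.differentiable (by simp) x
  have k1 := key (fun _ => 1) (0, Pi.single i 1, 0) contDiff_const (by simp)
  have k2 := key (fun ξ => -(2 * ξ.1 i)) (0, 0, 1) (by fun_prop) (by
    intro ξ
    refine fderiv_of_curve (by fun_prop) ?_
    have := ((curve_x ξ (0, 0, 1) i).const_mul (-2))
    simpa using this)
  simp only [one_mul] at k1
  simp only [Yd_eq]
  rw [integral_add k1.1 k2.1, k1.2, k2.2, add_zero]

/-! ### the fundamental solution is harmonic away from the origin -/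

lemma curve_pow (ξ v : H n) (h : ξ ≠ 0) (p : ℝ) : HasDerivAt (fun s : ℝ => NN (ξ + s • v) ^ p)
    ((4 * rsq ξ * mm ξ (v.1, v.2.1) + 2 * ξ.2.2 * v.2.2) * p * NN ξ ^ (p - 1)) 0 := by
  have hN := (NN_pos h).ne'
  have := (curve_NN ξ v).rpow_const (p := p) (Or.inl (by simpa using hN))
  simpa using this

/-- `N^{-n/2-1}` -/
def ww (ξ : H n) : ℝ := NN ξ ^ (-(n : ℝ) / 2 - 1)

def gx (i : Fin n) (ξ : H n) : ℝ := -(2 * n) * (ww ξ * (ξ.2.2 * ξ.2.1 i + rsq ξ * ξ.1 i))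
def gy (i : Fin n) (ξ : H n) : ℝ := -(2 * n) * (ww ξ * (rsq ξ * ξ.2.1 i - ξ.2.2 * ξ.1 i))

lemma contDiffAt_ww {k} {ξ : H n} (h : ξ ≠ 0) : ContDiffAt ℝ k (ww : H n → ℝ) ξ := by
  unfold ww
  exact contDiff_NN.contDiffAt.rpow_const_of_ne (NN_pos h).ne'

lemma contDiffAt_gx {k} (i : Fin n) {ξ : H n} (h : ξ ≠ 0) : ContDiffAt ℝ k (gx i) ξ := by
  unfold gx
  refine contDiffAt_const.mul ((contDiffAt_ww h).mul ?_)
  have := contDiff_rsq (n := n) (k := k)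
  exact ContDiff.contDiffAt (by fun_prop)

lemma contDiffAt_gy {k} (i : Fin n) {ξ : H n} (h : ξ ≠ 0) : ContDiffAt ℝ k (gy i) ξ := by
  unfold gy
  refine contDiffAt_const.mul ((contDiffAt_ww h).mul ?_)
  have := contDiff_rsq (n := n) (k := k)
  exact ContDiff.contDiffAt (by fun_prop)

lemma mm_single1 (ξ : H n) (i : Fin n) : mm ξ (Pi.single i 1, 0) = ξ.1 i := by
  simp [mm, Pi.single_apply]
lemma mm_single2 (ξ : H n) (i : Fin n) : mm ξ (0, Pi.single i 1) = ξ.2.1 i := by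
  simp [mm, Pi.single_apply]

lemma Xd_hh {ξ : H n} (h : ξ ≠ 0) (i : Fin n) : Xd i hh ξ = gx i ξ := by
  unfold Xd
  refine fderiv_of_curve ((contDiffAt_hh (k := 1) h).differentiableAt (by simp)) ?_
  refine (curve_pow ξ _ h _).congr_deriv ?_
  simp only [mm_single1, gx, ww]
  ring

lemma Yd_hh {ξ : H n} (h : ξ ≠ 0) (i : Fin n) : Yd i hh ξ = gy i ξ := by
  unfold Yd
  refine fderiv_of_curve ((contDiffAt_hh (k := 1) h).differentiableAt (by simp)) ?_
  refine (curve_pow ξ _ h _).congr_deriv ?_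
  simp only [mm_single2, gy, ww]
  ring

lemma Xd_gx {ξ : H n} (h : ξ ≠ 0) (i : Fin n) : Xd i (gx i) ξ =
    -(2 * n) * (-(2 * n + 4) * NN ξ ^ (-(n : ℝ) / 2 - 1 - 1)
      * (ξ.2.2 * ξ.2.1 i + rsq ξ * ξ.1 i) ^ 2
      + ww ξ * (2 * ξ.1 i ^ 2 + 2 * ξ.2.1 i ^ 2 + rsq ξ)) := by
  unfold Xd
  refine fderiv_of_curve ((contDiffAt_gx (k := 1) i h).differentiableAt (by simp)) ?_
  have h1 := curve_pow ξ (Pi.single i 1, 0, 2 * ξ.2.1 i) h (-(n : ℝ) / 2 - 1)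
  have h2 := curve_rsq ξ (Pi.single i 1, 0, 2 * ξ.2.1 i)
  have h3 := curve_t ξ (Pi.single i 1, 0, 2 * ξ.2.1 i)
  have h4 := curve_x ξ (Pi.single i 1, 0, 2 * ξ.2.1 i) i
  have h5 := curve_y ξ (Pi.single i 1, 0, 2 * ξ.2.1 i) i
  refine ((h1.mul ((h3.mul h5).add (h2.mul h4))).const_mul (-(2 * (n:ℝ)))).congr_deriv ?_
  simp only [zero_smul, add_zero, mm_single1, Pi.single_eq_same, Pi.zero_apply, ww, Pi.mul_apply,
    Pi.add_apply, Pi.sub_apply]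
  ring

lemma Yd_gy {ξ : H n} (h : ξ ≠ 0) (i : Fin n) : Yd i (gy i) ξ =
    -(2 * n) * (-(2 * n + 4) * NN ξ ^ (-(n : ℝ) / 2 - 1 - 1)
      * (rsq ξ * ξ.2.1 i - ξ.2.2 * ξ.1 i) ^ 2
      + ww ξ * (2 * ξ.1 i ^ 2 + 2 * ξ.2.1 i ^ 2 + rsq ξ)) := by
  unfold Yd
  refine fderiv_of_curve ((contDiffAt_gy (k := 1) i h).differentiableAt (by simp)) ?_
  have h1 := curve_pow ξ (0, Pi.single i 1, -(2 * ξ.1 i)) h (-(n : ℝ) / 2 - 1)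
  have h2 := curve_rsq ξ (0, Pi.single i 1, -(2 * ξ.1 i))
  have h3 := curve_t ξ (0, Pi.single i 1, -(2 * ξ.1 i))
  have h4 := curve_x ξ (0, Pi.single i 1, -(2 * ξ.1 i)) i
  have h5 := curve_y ξ (0, Pi.single i 1, -(2 * ξ.1 i)) i
  refine ((h1.mul ((h2.mul h5).sub (h3.mul h4))).const_mul (-(2 * (n:ℝ)))).congr_deriv ?_
  simp only [zero_smul, add_zero, mm_single2, Pi.single_eq_same, Pi.zero_apply, ww, Pi.mul_apply,
    Pi.add_apply, Pi.sub_apply]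
  ring

lemma subLap_hh {ξ : H n} (h : ξ ≠ 0) : ∑ i, (Xd i (gx i) ξ + Yd i (gy i) ξ) = 0 := by
  have hN := NN_pos h
  have hw : ww ξ = NN ξ ^ (-(n : ℝ) / 2 - 1 - 1) * NN ξ := by
    unfold ww
    rw [← Real.rpow_add_one hN.ne']
    congr 1; ring
  have e : ∀ i, Xd i (gx i) ξ + Yd i (gy i) ξ = (-(2 * n) * NN ξ ^ (-(n : ℝ) / 2 - 1 - 1) * NN ξ) *
      ((-(2 * n + 4) + 4) * (ξ.1 i ^ 2 + ξ.2.1 i ^ 2) + 2 * rsq ξ) := by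
    intro i
    rw [Xd_gx h, Yd_gy h, hw]
    unfold NN
    ring
  rw [Finset.sum_congr rfl fun i _ => e i, ← Finset.mul_sum, Finset.sum_add_distrib,
    ← Finset.mul_sum, rsq_eq]
  simp
  right; ring

end Heisenberg

namespace Heisenberg
variable {n : ℕ}
set_option linter.unusedVariables false
set_option linter.unusedSimpArgs false

lemma dichotomy (Φ : (H n → ℝ) → (H n → ℝ)) (T : (H n → ℝ) → ℝ)
    (hT : ∀ φ, IsTest univ φ → ∫ ξ, Φ φ ξ = T φ)
    (hΦ : ∀ φ ψ, IsTest univ φ → IsTest univ ψ → Φ (fun ξ => φ ξ + ψ ξ) = Φ φ + Φ ψ)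
    (hTa : ∀ φ ψ, IsTest univ φ → IsTest univ ψ → T (fun ξ => φ ξ + ψ ξ) = T φ + T ψ)
    {ψ : H n → ℝ} (hψ : IsTest univ ψ) (h0 : T ψ ≠ 0) :
    ∀ φ, IsTest univ φ → Integrable (Φ φ) := by
  have key : ∀ φ, IsTest univ φ → T φ ≠ 0 → Integrable (Φ φ) := by
    intro φ hφ h
    by_contra hc
    rw [← hT φ hφ, integral_undef hc] at h
    exact h rfl
  intro φ hφ
  by_cases h : T φ = 0
  · have h1 := key _ (hφ.add hψ) (by rw [hTa _ _ hφ hψ, h, zero_add]; exact h0)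
    rw [hΦ _ _ hφ hψ] at h1
    have := h1.sub (key ψ hψ h0)
    simpa using this
  · exact key φ hφ h

/-- a sequence of cut-off functions -/
def bumpS (n k : ℕ) : ContDiffBump (0 : H n) :=
  ⟨k + 1, k + 2, by positivity, by linarith⟩

lemma isTest_bump (k : ℕ) : IsTest univ (bumpS n k : H n → ℝ) :=
  ⟨(bumpS n k).contDiff, (bumpS n k).hasCompactSupport, subset_univ _⟩

lemma bump_eventually (ξ : H n) : ∀ᶠ k : ℕ in atTop, (bumpS n k : H n → ℝ) =ᶠ[𝓝 ξ] 1 := by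
  obtain ⟨N, hN⟩ := exists_nat_gt ‖ξ‖
  filter_upwards [eventually_ge_atTop N] with k hk
  refine (bumpS n k).eventuallyEq_one_of_mem_ball ?_
  have : (N : ℝ) ≤ k := by exact_mod_cast hk
  simp only [mem_ball_zero_iff, bumpS]
  linarith

lemma meas_of_seq {g : H n → ℝ} (s : ℕ → H n → ℝ) (hs : ∀ k, Integrable (s k))
    (h : ∀ ξ, ∀ᶠ k in atTop, s k ξ = g ξ) : AEStronglyMeasurable g := by
  refine aestronglyMeasurable_of_tendsto_ae atTop (fun k => (hs k).aestronglyMeasurable) ?_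
  refine Eventually.of_forall fun ξ => ?_
  exact tendsto_nhds_of_eventually_eq (h ξ)

lemma transfer {u : H n → ℝ} (S : H n ≃L[ℝ] H n) (huS : ∀ ξ, u (S ξ) = u ξ)
    (a b : H n → H n) (c : ℝ) (hc : c ≠ 0) (hab : ∀ ξ, S (a ξ) = c • b (S ξ))
    (h : ∀ φ, IsTest univ φ → ∫ ξ, u ξ * fderiv ℝ φ ξ (a ξ) = 0) :
    ∀ φ, IsTest univ φ → ∫ ξ, u ξ * fderiv ℝ φ ξ (b ξ) = 0 := by
  intro φ hφ
  have ht : IsTest univ (φ ∘ S) :=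
    ⟨hφ.contDiff.comp S.contDiff, hφ.compactSupport.comp_homeomorph S.toHomeomorph, subset_univ _⟩
  have h1 := h _ ht
  have e : ∀ ξ, u ξ * fderiv ℝ (φ ∘ S) ξ (a ξ) = c * (u (S ξ) * fderiv ℝ φ (S ξ) (b (S ξ))) := by
    intro ξ
    rw [fderiv_comp ξ (hφ.contDiff.differentiable (by simp) _) S.differentiableAt]
    rw [ContinuousLinearMap.comp_apply, ContinuousLinearEquiv.fderiv]
    rw [show ((S : H n →L[ℝ] H n) (a ξ)) = c • b (S ξ) from hab ξ, map_smul, huS, smul_eq_mul]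
    ring
  simp only [e] at h1
  rw [integral_const_mul] at h1
  have h2 := (mul_eq_zero.1 h1).resolve_left hc
  have := integral_image_eq_integral_abs_det_fderiv_smul (μ := (volume : Measure (H n)))
    (s := univ) (f := S) (f' := fun ξ => (S : H n →L[ℝ] H n))
    MeasurableSet.univ (fun x hx => S.hasFDerivWithinAt)
    (S.injective.injOn) (fun ξ => u ξ * fderiv ℝ φ ξ (b ξ))
  rw [image_univ, S.surjective.range_eq, Measure.restrict_univ] at this
  rw [this]
  simp only [smul_eq_mul]
  rw [integral_const_mul, h2, mul_zero]

/-- the coordinate swap -/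
def swapE (i j : Fin n) : H n ≃L[ℝ] H n :=
  LinearEquiv.toContinuousLinearEquiv
  { toFun := fun ξ => (fun k => ξ.1 (Equiv.swap i j k), fun k => ξ.2.1 (Equiv.swap i j k), ξ.2.2)
    invFun := fun ξ => (fun k => ξ.1 (Equiv.swap i j k), fun k => ξ.2.1 (Equiv.swap i j k), ξ.2.2)
    map_add' := fun a b => rfl
    map_smul' := fun a b => rfl
    left_inv := fun ξ => by simp
    right_inv := fun ξ => by simp }

/-- the complex structure -/
def rotE : H n ≃L[ℝ] H n :=
  LinearEquiv.toContinuousLinearEquiv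
  { toFun := fun ξ => (ξ.2.1, -ξ.1, ξ.2.2)
    invFun := fun ξ => (-ξ.2.1, ξ.1, ξ.2.2)
    map_add' := fun a b => by
      refine Prod.ext rfl (Prod.ext ?_ rfl)
      simp [add_comm]
    map_smul' := fun a b => by
      refine Prod.ext rfl (Prod.ext ?_ rfl)
      simp
    left_inv := fun ξ => by simp
    right_inv := fun ξ => by simp }

lemma swapE_apply (i j : Fin n) (ξ : H n) : swapE i j ξ =
  (fun k => ξ.1 (Equiv.swap i j k), fun k => ξ.2.1 (Equiv.swap i j k), ξ.2.2) := rfl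
lemma rotE_apply (ξ : H n) : rotE ξ = (ξ.2.1, -ξ.1, ξ.2.2) := rfl

lemma rsq_swapE (i j : Fin n) (ξ : H n) : rsq (swapE i j ξ) = rsq ξ := by
  rw [swapE_apply]
  unfold rsq
  simp only
  rw [Equiv.sum_comp (Equiv.swap i j) (fun k => ξ.1 k ^ 2),
    Equiv.sum_comp (Equiv.swap i j) (fun k => ξ.2.1 k ^ 2)]

lemma rsq_rotE (ξ : H n) : rsq (rotE ξ) = rsq ξ := by
  rw [rotE_apply]
  unfold rsq
  simp [add_comm]

lemma single_swap (i j : Fin n) :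
    (fun k => (Pi.single i 1 : Fin n → ℝ) (Equiv.swap i j k)) = Pi.single j 1 := by
  funext k
  simp only [Pi.single_apply]
  congr 1
  simp only [eq_iff_iff]
  constructor
  · intro h
    have := congrArg (Equiv.swap i j) h
    simpa using this
  · rintro rfl; simp

lemma zeroX_all {u : H n → ℝ} (hc : IsCylindrical u) (i : Fin n)
    (h : ∀ φ, IsTest univ φ → ∫ ξ, u ξ * Xd i φ ξ = 0) (j : Fin n) :
    ∀ φ, IsTest univ φ → ∫ ξ, u ξ * Xd j φ ξ = 0 := by
  refine transfer (swapE i j) (fun ξ => hc _ _ (rsq_swapE i j ξ) rfl)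
    (fun ξ => (Pi.single i 1, 0, 2 * ξ.2.1 i)) (fun ξ => (Pi.single j 1, 0, 2 * ξ.2.1 j)) 1
    one_ne_zero ?_ h
  intro ξ
  rw [one_smul, swapE_apply, swapE_apply]
  refine Prod.ext (single_swap i j) (Prod.ext rfl ?_)
  simp

lemma zeroX_Y {u : H n → ℝ} (hc : IsCylindrical u) (i : Fin n)
    (h : ∀ φ, IsTest univ φ → ∫ ξ, u ξ * Xd i φ ξ = 0) :
    ∀ φ, IsTest univ φ → ∫ ξ, u ξ * Yd i φ ξ = 0 := by
  refine transfer rotE (fun ξ => hc _ _ (rsq_rotE ξ) rfl)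
    (fun ξ => (Pi.single i 1, 0, 2 * ξ.2.1 i)) (fun ξ => (0, Pi.single i 1, -(2 * ξ.1 i))) (-1)
    (by norm_num) ?_ h
  intro ξ
  rw [rotE_apply, rotE_apply]
  simp

lemma zeroY_X {u : H n → ℝ} (hc : IsCylindrical u) (i : Fin n)
    (h : ∀ φ, IsTest univ φ → ∫ ξ, u ξ * Yd i φ ξ = 0) :
    ∀ φ, IsTest univ φ → ∫ ξ, u ξ * Xd i φ ξ = 0 := by
  refine transfer rotE (fun ξ => hc _ _ (rsq_rotE ξ) rfl)
    (fun ξ => (0, Pi.single i 1, -(2 * ξ.1 i))) (fun ξ => (Pi.single i 1, 0, 2 * ξ.2.1 i)) 1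
    (by norm_num) ?_ h
  intro ξ
  rw [rotE_apply, rotE_apply]
  simp

lemma Xd_add (i : Fin n) {c ψ : H n → ℝ} {ξ : H n} (hc : DifferentiableAt ℝ c ξ)
    (hψ : DifferentiableAt ℝ ψ ξ) :
    Xd i (fun ξ => c ξ + ψ ξ) ξ = Xd i c ξ + Xd i ψ ξ := by
  unfold Xd
  rw [fderiv_fun_add hc hψ]; simp

lemma Yd_add (i : Fin n) {c ψ : H n → ℝ} {ξ : H n} (hc : DifferentiableAt ℝ c ξ)
    (hψ : DifferentiableAt ℝ ψ ξ) :
    Yd i (fun ξ => c ξ + ψ ξ) ξ = Yd i c ξ + Yd i ψ ξ := by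
  unfold Yd
  rw [fderiv_fun_add hc hψ]; simp

lemma IsTest.diff {Ω : Set (H n)} {φ : H n → ℝ} (h : IsTest Ω φ) (ξ : H n) :
    DifferentiableAt ℝ φ ξ := h.contDiff.differentiable (by simp) ξ

lemma hGrad_add {φ ψ : H n → ℝ} {ξ : H n} (hc : DifferentiableAt ℝ φ ξ)
    (hψ : DifferentiableAt ℝ ψ ξ) :
    hGrad (fun ξ => φ ξ + ψ ξ) ξ = hGrad φ ξ + hGrad ψ ξ :=
  Prod.ext (funext fun i => Xd_add i hc hψ) (funext fun i => Yd_add i hc hψ)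

lemma int_cont_hcs {a b : H n → ℝ} (ha : Continuous a) (hb : Continuous b)
    (hs : HasCompactSupport b) : Integrable (fun ξ => a ξ * b ξ) :=
  (ha.mul hb).integrable_of_hasCompactSupport (hs.mul_left (f := a))

lemma hGrad_congr {φ ψ : H n → ℝ} {ξ : H n} (h : φ =ᶠ[𝓝 ξ] ψ) : hGrad φ ξ = hGrad ψ ξ := by
  unfold hGrad Xd Yd
  rw [h.fderiv_eq]

lemma hGrad_linear (w : V n) (ξ : H n) :
    hGrad (fun η : H n => ∑ i, w.1 i * η.1 i + ∑ i, w.2 i * η.2.1 i) ξ = w := by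
  apply hdot_ext
  intro v
  rw [← fderiv_lift]
  refine fderiv_of_curve (by fun_prop) ?_
  have h1 : HasDerivAt (fun s : ℝ => ∑ i, w.1 i * (ξ + s • lift ξ v).1 i) (∑ i, w.1 i * v.1 i) 0 := by
    refine HasDerivAt.fun_sum fun i _ => ?_
    exact (curve_x ξ (lift ξ v) i).const_mul _
  have h2 : HasDerivAt (fun s : ℝ => ∑ i, w.2 i * (ξ + s • lift ξ v).2.1 i)
      (∑ i, w.2 i * v.2 i) 0 := by
    refine HasDerivAt.fun_sum fun i _ => ?_
    exact (curve_y ξ (lift ξ v) i).const_mul _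
  refine (h1.add h2).congr_deriv ?_
  simp only [hdot, mul_comm]

/-- A weak gradient with measurable components -/
structure GoodGrad (u F : H n → ℝ) (G : H n → V n) : Prop where
  weak : IsWeakHGrad univ u G
  eqn : ∀ φ : H n → ℝ, IsTest univ φ → ∫ ξ, hdot (G ξ) (hGrad φ ξ) = ∫ ξ, F ξ * φ ξ
  mX : ∀ i, AEStronglyMeasurable (fun ξ => (G ξ).1 i)
  mY : ∀ i, AEStronglyMeasurable (fun ξ => (G ξ).2 i)

theorem exists_goodGrad {u F : H n → ℝ} (hu : Continuous u) (hF : Continuous F)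
    (hc : IsCylindrical u) (h : IsWeakSol univ u F) : ∃ G, GoodGrad u F G := by
  obtain ⟨G, hG, hE⟩ := h
  by_cases hm : (∀ i, AEStronglyMeasurable (fun ξ => (G ξ).1 i)) ∧
    (∀ i, AEStronglyMeasurable (fun ξ => (G ξ).2 i))
  · exact ⟨G, hG, hE, hm.1, hm.2⟩
  have hS : ∀ φ, IsTest univ φ → ∫ ξ, F ξ * φ ξ = 0 := by
    by_contra hcon
    push Not at hcon
    obtain ⟨ψ, hψ, h0⟩ := hcon
    have hI := dichotomy (fun φ ξ => hdot (G ξ) (hGrad φ ξ)) (fun φ => ∫ ξ, F ξ * φ ξ) hE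
      (by
        intro φ ψ hφ hψ
        funext ξ
        simp only [Pi.add_apply]
        rw [hGrad_add (hφ.diff ξ) (hψ.diff ξ), hdot_add_right])
      (by
        intro φ ψ hφ hψ
        simp only [mul_add]
        exact integral_add (int_cont_hcs hF hφ.contDiff.continuous hφ.compactSupport)
          (int_cont_hcs hF hψ.contDiff.continuous hψ.compactSupport)) hψ h0
    have hmeas : ∀ w : V n, AEStronglyMeasurable (fun ξ => hdot (G ξ) w) := by
      intro w
      refine meas_of_seq _ (fun k => hI _ ((isTest_bump k).mulCont
        (c := fun η : H n => ∑ i, w.1 i * η.1 i + ∑ i, w.2 i * η.2.1 i) (by fun_prop))) ?_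
      intro ξ
      filter_upwards [bump_eventually ξ] with k hk
      congr 1
      rw [← hGrad_linear w ξ]
      apply hGrad_congr
      filter_upwards [hk] with η hη
      simp [hη, hGrad_linear]
    apply hm
    constructor
    · intro i
      simpa [hdot, Pi.single_apply] using hmeas (Pi.single i 1, 0)
    · intro i
      simpa [hdot, Pi.single_apply] using hmeas (0, Pi.single i 1)
  have hX : ∀ i, ¬ AEStronglyMeasurable (fun ξ => (G ξ).1 i) →
      ∀ φ, IsTest univ φ → ∫ ξ, u ξ * Xd i φ ξ = 0 := by
    intro i hi
    by_contra hcon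
    push Not at hcon
    obtain ⟨ψ, hψ, h0⟩ := hcon
    have hI := dichotomy (fun φ ξ => (G ξ).1 i * φ ξ) (fun φ => -∫ ξ, u ξ * Xd i φ ξ)
      (fun φ hφ => by rw [hG.ibpX i φ hφ, neg_neg])
      (by
        intro φ ψ hφ hψ
        funext ξ
        simp only [Pi.add_apply]; ring)
      (by
        intro φ ψ hφ hψ
        rw [← neg_add, ← integral_add (int_cont_hcs hu (hφ.Xd_cont i) (hφ.Xd_hcs i))
          (int_cont_hcs hu (hψ.Xd_cont i) (hψ.Xd_hcs i))]
        congr 2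
        funext ξ
        rw [Xd_add i (hφ.diff ξ) (hψ.diff ξ), mul_add]) hψ (neg_ne_zero.2 h0)
    refine hi (meas_of_seq _ (fun k => hI _ (isTest_bump k)) ?_)
    intro ξ
    filter_upwards [bump_eventually ξ] with k hk
    simp [hk.eq_of_nhds]
  have hY : ∀ i, ¬ AEStronglyMeasurable (fun ξ => (G ξ).2 i) →
      ∀ φ, IsTest univ φ → ∫ ξ, u ξ * Yd i φ ξ = 0 := by
    intro i hi
    by_contra hcon
    push Not at hcon
    obtain ⟨ψ, hψ, h0⟩ := hcon
    have hI := dichotomy (fun φ ξ => (G ξ).2 i * φ ξ) (fun φ => -∫ ξ, u ξ * Yd i φ ξ)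
      (fun φ hφ => by rw [hG.ibpY i φ hφ, neg_neg])
      (by
        intro φ ψ hφ hψ
        funext ξ
        simp only [Pi.add_apply]; ring)
      (by
        intro φ ψ hφ hψ
        rw [← neg_add, ← integral_add (int_cont_hcs hu (hφ.Yd_cont i) (hφ.Yd_hcs i))
          (int_cont_hcs hu (hψ.Yd_cont i) (hψ.Yd_hcs i))]
        congr 2
        funext ξ
        rw [Yd_add i (hφ.diff ξ) (hψ.diff ξ), mul_add]) hψ (neg_ne_zero.2 h0)
    refine hi (meas_of_seq _ (fun k => hI _ (isTest_bump k)) ?_)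
    intro ξ
    filter_upwards [bump_eventually ξ] with k hk
    simp [hk.eq_of_nhds]
  have hXall : ∀ j, ∀ φ, IsTest univ φ → ∫ ξ, u ξ * Xd j φ ξ = 0 := by
    rw [not_and_or] at hm
    push Not at hm
    rcases hm with ⟨i, hi⟩ | ⟨i, hi⟩
    · exact zeroX_all hc i (hX i hi)
    · exact zeroX_all hc i (zeroY_X hc i (hY i hi))
  refine ⟨fun _ => 0, ⟨hG.locInt, ?_, ?_, ?_⟩, ?_, ?_, ?_⟩
  · intro K _ _; simp
  · intro i φ hφ; simpa using hXall i φ hφ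
  · intro i φ hφ; simpa using zeroX_Y hc i (hXall i) φ hφ
  · intro φ hφ
    rw [hS φ hφ]
    simp [hdot]
  · intro i; exact aestronglyMeasurable_const
  · intro i; exact aestronglyMeasurable_const

end Heisenberg

namespace Heisenberg
variable {n : ℕ}
set_option linter.unusedVariables false
set_option linter.unusedSimpArgs false

/-! ### smoothness of the coefficients -/

lemma contDiff_mm {k} (e : V n) : ContDiff ℝ k (fun ξ : H n => mm ξ e) := by
  unfold mm; fun_prop
lemma contDiff_kk {k} (e : V n) : ContDiff ℝ k (fun ξ : H n => kk ξ e) := by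
  unfold kk; fun_prop
lemma contDiffAt_kap {k} {ξ : H n} (h : ξ ≠ 0) : ContDiffAt ℝ k (kap : H n → ℝ) ξ := by
  unfold kap
  have h1 := contDiff_rsq (n := n) (k := k)
  have h2 := contDiff_NN (n := n) (k := k)
  exact ContDiffAt.div (ContDiff.contDiffAt (by fun_prop)) (ContDiff.contDiffAt (by fun_prop))
    (pow_ne_zero 2 (NN_pos h).ne')
lemma contDiffAt_lam {k} {ξ : H n} (h : ξ ≠ 0) : ContDiffAt ℝ k (lam : H n → ℝ) ξ := by
  unfold lam
  have h1 := contDiff_rsq (n := n) (k := k)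
  have h2 := contDiff_NN (n := n) (k := k)
  exact ContDiffAt.div (ContDiff.contDiffAt (by fun_prop)) (ContDiff.contDiffAt (by fun_prop))
    (pow_ne_zero 2 (NN_pos h).ne')

lemma contDiffAt_Ah1 {k} (e : V n) (j : Fin n) {ξ : H n} (h : ξ ≠ 0) :
    ContDiffAt ℝ k (fun ξ => (Ah ξ e).1 j) ξ := by
  have h1 := contDiff_rsq (n := n) (k := k)
  have h2 := contDiff_NN (n := n) (k := k)
  have h3 := contDiff_mm (k := k) e
  have h4 := contDiff_kk (k := k) e
  have h5 : ContDiffAt ℝ k (fun ξ : H n => (ξ.2.2 * e.1 j + rsq ξ * e.2 j) / NN ξ) ξ :=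
    ContDiffAt.div (ContDiff.contDiffAt (by fun_prop)) h2.contDiffAt (NN_pos h).ne'
  exact (h5.add ((contDiffAt_kap h).mul (ContDiff.contDiffAt (by fun_prop)))).sub
    ((contDiffAt_lam h).mul (ContDiff.contDiffAt (by fun_prop)))

lemma contDiffAt_Ah2 {k} (e : V n) (j : Fin n) {ξ : H n} (h : ξ ≠ 0) :
    ContDiffAt ℝ k (fun ξ => (Ah ξ e).2 j) ξ := by
  have h1 := contDiff_rsq (n := n) (k := k)
  have h2 := contDiff_NN (n := n) (k := k)
  have h3 := contDiff_mm (k := k) e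
  have h4 := contDiff_kk (k := k) e
  have h5 : ContDiffAt ℝ k (fun ξ : H n => (ξ.2.2 * e.2 j - rsq ξ * e.1 j) / NN ξ) ξ :=
    ContDiffAt.div (ContDiff.contDiffAt (by fun_prop)) h2.contDiffAt (NN_pos h).ne'
  unfold Ah
  simp only
  have h6 := contDiffAt_kap (k := k) h
  have h7 := contDiffAt_lam (k := k) h
  fun_prop

/-! ### integrability with respect to good gradients -/

variable {u F : H n → ℝ} {G : H n → V n}

lemma GoodGrad.locX (hG : GoodGrad u F G) (i : Fin n) :
    LocallyIntegrable (fun ξ => (G ξ).1 i) := by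
  rw [locallyIntegrable_iff]
  intro K hK
  have h1 := hG.weak.locSq K (subset_univ _) hK
  have h2 : IntegrableOn (fun _ : H n => (1 : ℝ)) K := continuousOn_const.integrableOn_compact hK
  refine (h2.add h1).mono' (hG.mX i).restrict (Eventually.of_forall fun ξ => ?_)
  have h3 : ‖(G ξ).1 i‖ ≤ ‖G ξ‖ := (norm_le_pi_norm _ i).trans (norm_fst_le _)
  simp only [Pi.add_apply]
  nlinarith [sq_nonneg (‖G ξ‖ - 1), norm_nonneg (G ξ)]

lemma GoodGrad.locY (hG : GoodGrad u F G) (i : Fin n) :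
    LocallyIntegrable (fun ξ => (G ξ).2 i) := by
  rw [locallyIntegrable_iff]
  intro K hK
  have h1 := hG.weak.locSq K (subset_univ _) hK
  have h2 : IntegrableOn (fun _ : H n => (1 : ℝ)) K := continuousOn_const.integrableOn_compact hK
  refine (h2.add h1).mono' (hG.mY i).restrict (Eventually.of_forall fun ξ => ?_)
  have h3 : ‖(G ξ).2 i‖ ≤ ‖G ξ‖ := (norm_le_pi_norm _ i).trans (norm_snd_le _)
  simp only [Pi.add_apply]
  nlinarith [sq_nonneg (‖G ξ‖ - 1), norm_nonneg (G ξ)]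

lemma GoodGrad.intX (hG : GoodGrad u F G) (i : Fin n) {φ : H n → ℝ} (hφ : Continuous φ)
    (hs : HasCompactSupport φ) : Integrable (fun ξ => (G ξ).1 i * φ ξ) := by
  have := (hG.locX i).integrable_smul_left_of_hasCompactSupport hφ hs
  simpa [mul_comm] using this

lemma GoodGrad.intY (hG : GoodGrad u F G) (i : Fin n) {φ : H n → ℝ} (hφ : Continuous φ)
    (hs : HasCompactSupport φ) : Integrable (fun ξ => (G ξ).2 i * φ ξ) := by
  have := (hG.locY i).integrable_smul_left_of_hasCompactSupport hφ hs
  simpa [mul_comm] using this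

lemma GoodGrad.intDot (hG : GoodGrad u F G) {c1 c2 : Fin n → H n → ℝ}
    (h1 : ∀ i, Continuous (c1 i)) (h1' : ∀ i, HasCompactSupport (c1 i))
    (h2 : ∀ i, Continuous (c2 i)) (h2' : ∀ i, HasCompactSupport (c2 i)) :
    Integrable (fun ξ => hdot (G ξ) (fun i => c1 i ξ, fun i => c2 i ξ)) := by
  unfold hdot
  exact (integrable_finsetSum _ fun i _ => hG.intX i (h1 i) (h1' i)).add
    (integrable_finsetSum _ fun i _ => hG.intY i (h2 i) (h2' i))

/-- horizontal divergence -/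
def dvg (c1 c2 : Fin n → H n → ℝ) (ξ : H n) : ℝ := ∑ i, (Xd i (c1 i) ξ + Yd i (c2 i) ξ)

lemma int_dvg (hu : Continuous u) {c1 c2 : Fin n → H n → ℝ}
    (h1 : ∀ i, IsTest univ (c1 i)) (h2 : ∀ i, IsTest univ (c2 i)) :
    Integrable (fun ξ => u ξ * dvg c1 c2 ξ) := by
  have : ∀ ξ, u ξ * dvg c1 c2 ξ = ∑ i, (u ξ * Xd i (c1 i) ξ + u ξ * Yd i (c2 i) ξ) := by
    intro ξ
    unfold dvg
    rw [Finset.mul_sum]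
    simp only [mul_add]
  simp only [this]
  exact integrable_finsetSum _ fun i _ =>
    (int_cont_hcs hu ((h1 i).Xd_cont i) ((h1 i).Xd_hcs i)).add
      (int_cont_hcs hu ((h2 i).Yd_cont i) ((h2 i).Yd_hcs i))

lemma GoodGrad.ibp (hu : Continuous u) (hG : GoodGrad u F G) {c1 c2 : Fin n → H n → ℝ}
    (h1 : ∀ i, IsTest univ (c1 i)) (h2 : ∀ i, IsTest univ (c2 i)) :
    ∫ ξ, u ξ * dvg c1 c2 ξ = -∫ ξ, hdot (G ξ) (fun i => c1 i ξ, fun i => c2 i ξ) := by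
  have : ∀ ξ, u ξ * dvg c1 c2 ξ = ∑ i, (u ξ * Xd i (c1 i) ξ + u ξ * Yd i (c2 i) ξ) := by
    intro ξ
    unfold dvg
    rw [Finset.mul_sum]
    simp only [mul_add]
  simp only [this, hdot_eq]
  have j1 : ∀ i ∈ Finset.univ,
      Integrable (fun ξ => u ξ * Xd i (c1 i) ξ + u ξ * Yd i (c2 i) ξ) := fun i _ =>
    (int_cont_hcs hu ((h1 i).Xd_cont i) ((h1 i).Xd_hcs i)).add
      (int_cont_hcs hu ((h2 i).Yd_cont i) ((h2 i).Yd_hcs i))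
  have j2 : ∀ i ∈ Finset.univ,
      Integrable (fun ξ => (G ξ).1 i * c1 i ξ + (G ξ).2 i * c2 i ξ) := fun i _ =>
    (hG.intX i (h1 i).contDiff.continuous (h1 i).compactSupport).add
      (hG.intY i (h2 i).contDiff.continuous (h2 i).compactSupport)
  rw [integral_finsetSum _ j1, integral_finsetSum _ j2, ← Finset.sum_neg_distrib]
  refine Finset.sum_congr rfl fun i _ => ?_
  rw [integral_add (int_cont_hcs hu ((h1 i).Xd_cont i) ((h1 i).Xd_hcs i))
      (int_cont_hcs hu ((h2 i).Yd_cont i) ((h2 i).Yd_hcs i)),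
    integral_add (hG.intX i (h1 i).contDiff.continuous (h1 i).compactSupport)
      (hG.intY i (h2 i).contDiff.continuous (h2 i).compactSupport), neg_add,
    hG.weak.ibpX i _ (h1 i), hG.weak.ibpY i _ (h2 i)]

lemma goodGrad_one : GoodGrad (fun _ : H n => (1 : ℝ)) (fun _ => 0) (fun _ => 0) := by
  refine ⟨⟨?_, ?_, ?_, ?_⟩, ?_, ?_, ?_⟩
  · exact continuous_const.locallyIntegrable.locallyIntegrableOn _
  · intro K _ _; simp
  · intro i φ hφ; simpa using integral_Xd i hφ
  · intro i φ hφ; simpa using integral_Yd i hφ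
  · intro φ hφ; simp [hdot]
  · intro i; exact aestronglyMeasurable_const
  · intro i; exact aestronglyMeasurable_const

lemma dvg_mul {c1 c2 : Fin n → H n → ℝ} {ψ : H n → ℝ} {ξ : H n}
    (h1 : ∀ i, ContDiffAt ℝ 1 (c1 i) ξ) (h2 : ∀ i, ContDiffAt ℝ 1 (c2 i) ξ)
    (hψ : DifferentiableAt ℝ ψ ξ) :
    dvg (fun i ξ => c1 i ξ * ψ ξ) (fun i ξ => c2 i ξ * ψ ξ) ξ =
      ψ ξ * dvg c1 c2 ξ + hdot (fun i => c1 i ξ, fun i => c2 i ξ) (hGrad ψ ξ) := by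
  unfold dvg
  rw [hdot_eq, Finset.mul_sum, ← Finset.sum_add_distrib]
  refine Finset.sum_congr rfl fun i _ => ?_
  rw [Xd_mul i ((h1 i).differentiableAt (by simp)) hψ, Yd_mul i ((h2 i).differentiableAt (by simp)) hψ]
  simp only [hGrad]
  ring

lemma cont_mulC {c ψ : H n → ℝ} (hc : ∀ ξ ≠ 0, ContinuousAt c ξ) (hψ : Continuous ψ)
    (hs : tsupport ψ ⊆ {0}ᶜ) : Continuous (fun ξ => c ξ * ψ ξ) := by
  rw [continuous_iff_continuousAt]
  intro ξ
  by_cases h : ξ ∈ tsupport ψ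
  · exact (hc ξ (hs h)).mul hψ.continuousAt
  · have := notMem_tsupport_iff_eventuallyEq.1 h
    have h2 : (fun ξ => c ξ * ψ ξ) =ᶠ[𝓝 ξ] fun _ => 0 := by
      filter_upwards [this] with η hη
      simp [hη]
    exact continuousAt_const.congr h2.symm

lemma contAt_fderiv {c : H n → ℝ} {ξ : H n} (h : ContDiffAt ℝ 2 c ξ) :
    ContinuousAt (fderiv ℝ c) ξ :=
  (h.fderiv_right (m := 1) (by norm_num)).continuousAt

lemma contAt_Xd {c : H n → ℝ} {ξ : H n} (i : Fin n) (h : ContDiffAt ℝ 2 c ξ) :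
    ContinuousAt (Xd i c) ξ := by
  have := contAt_fderiv h
  exact this.clm_apply (Continuous.continuousAt (by fun_prop))

lemma contAt_Yd {c : H n → ℝ} {ξ : H n} (i : Fin n) (h : ContDiffAt ℝ 2 c ξ) :
    ContinuousAt (Yd i c) ξ := by
  have := contAt_fderiv h
  exact this.clm_apply (Continuous.continuousAt (by fun_prop))

lemma contAt_dvg {c1 c2 : Fin n → H n → ℝ} {ξ : H n}
    (h1 : ∀ i, ContDiffAt ℝ 2 (c1 i) ξ) (h2 : ∀ i, ContDiffAt ℝ 2 (c2 i) ξ) :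
    ContinuousAt (dvg c1 c2) ξ :=
  tendsto_finsetSum _ fun i _ => (contAt_Xd i (h1 i)).add (contAt_Yd i (h2 i))

/-! ### the transported vector field -/

def cX (e : V n) (i : Fin n) (η : H n) : ℝ :=
  hh (stil η) * NN (stil η) ^ (n + 1) * (Ah (stil η) e).1 i
def cY (e : V n) (i : Fin n) (η : H n) : ℝ :=
  hh (stil η) * NN (stil η) ^ (n + 1) * (Ah (stil η) e).2 i

lemma contDiffAt_cX {k} (e : V n) (i : Fin n) {η : H n} (h : η ≠ 0) :
    ContDiffAt ℝ k (cX e i) η := by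
  have hs := contDiffAt_stil (k := k) h
  have h' := stil_ne h
  have h1 : ContDiffAt ℝ k (fun ξ => hh ξ * NN ξ ^ (n + 1) * (Ah ξ e).1 i) (stil η) :=
    ((contDiffAt_hh h').mul (contDiff_NN.contDiffAt.pow _)).mul (contDiffAt_Ah1 e i h')
  exact h1.comp η hs

lemma contDiffAt_cY {k} (e : V n) (i : Fin n) {η : H n} (h : η ≠ 0) :
    ContDiffAt ℝ k (cY e i) η := by
  have hs := contDiffAt_stil (k := k) h
  have h' := stil_ne h
  have h1 : ContDiffAt ℝ k (fun ξ => hh ξ * NN ξ ^ (n + 1) * (Ah ξ e).2 i) (stil η) :=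
    ((contDiffAt_hh h').mul (contDiff_NN.contDiffAt.pow _)).mul (contDiffAt_Ah2 e i h')
  exact h1.comp η hs

lemma cvec_tilde (e : V n) (ξ : H n) :
    ((fun i => cX e i (tilde ξ), fun i => cY e i (tilde ξ)) : V n) =
      (hh ξ * NN ξ ^ (n + 1)) • Ah ξ e := by
  refine Prod.ext (funext fun i => ?_) (funext fun i => ?_)
  · simp [cX, stil_tilde]
  · simp [cY, stil_tilde]

/-- first form of the transported weak gradient -/
lemma weak_formula (hn : 1 ≤ n) (hu : Continuous u) (hG : GoodGrad u F G) (e : V n) {φ : H n → ℝ}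
    (hφ : IsTest {0}ᶜ φ) :
    ∫ ξ, hh ξ * u (tilde ξ) * hdot e (hGrad φ ξ) =
      -∫ ξ, (hh ξ * hdot e (AT ξ (G (tilde ξ)))
        + u (tilde ξ) * ((NN ξ ^ (n + 1))⁻¹ * dvg (cX e) (cY e) (tilde ξ))) * φ ξ := by
  set ψ : H n → ℝ := fun ξ => φ (stil ξ) with hψdef
  have hψ : IsTest {0}ᶜ ψ := hφ.compStil
  have hφψ : ∀ ξ, φ ξ = ψ (tilde ξ) := fun ξ => by simp [hψdef, stil_tilde]
  have hφψ' : φ = fun ξ => ψ (tilde ξ) := funext hφψ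
  have t1 : ∀ i, IsTest univ (fun ξ => cX e i ξ * ψ ξ) := fun i =>
    (hψ.mulC fun ξ h => contDiffAt_cX e i h).univ
  have t2 : ∀ i, IsTest univ (fun ξ => cY e i ξ * ψ ξ) := fun i =>
    (hψ.mulC fun ξ h => contDiffAt_cY e i h).univ
  -- left side
  have L : ∫ ξ, hh ξ * u (tilde ξ) * hdot e (hGrad φ ξ) =
      ∫ η, u η * hdot (fun i => cX e i η, fun i => cY e i η) (hGrad ψ η) := by
    rw [integral_tilde hn (fun η =>
      u η * hdot (fun i => cX e i η, fun i => cY e i η) (hGrad ψ η))]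
    refine integral_congr_ae ?_
    filter_upwards [ae_ne_zero hn] with ξ hξ
    have hN := (NN_pos hξ).ne'
    rw [cvec_tilde, hdot_smul_left, hφψ', hGrad_comp_tilde hξ (hψ.diff _), ← hdot_Ah]
    field_simp
  have M : ∫ η, u η * hdot (fun i => cX e i η, fun i => cY e i η) (hGrad ψ η) =
      ∫ η, (u η * dvg (fun i ξ => cX e i ξ * ψ ξ) (fun i ξ => cY e i ξ * ψ ξ) η
        - u η * (dvg (cX e) (cY e) η * ψ η)) := by
    refine integral_congr_ae ?_
    filter_upwards [ae_ne_zero hn] with ξ hξ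
    rw [dvg_mul (fun i => contDiffAt_cX e i hξ) (fun i => contDiffAt_cY e i hξ) (hψ.diff _)]
    ring
  have i1 := int_dvg hu t1 t2
  have c2 : Continuous (fun η => dvg (cX e) (cY e) η * ψ η) :=
    cont_mulC (fun ξ h => contAt_dvg (fun i => contDiffAt_cX e i h) (fun i => contDiffAt_cY e i h))
      hψ.contDiff.continuous hψ.supportSubset
  have s2 : HasCompactSupport (fun η => dvg (cX e) (cY e) η * ψ η) :=
    hψ.compactSupport.mul_left (f := dvg (cX e) (cY e))
  have i2 := int_cont_hcs hu c2 s2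
  have i3 := hG.intDot (fun i => (t1 i).contDiff.continuous) (fun i => (t1 i).compactSupport)
    (fun i => (t2 i).contDiff.continuous) (fun i => (t2 i).compactSupport)
  rw [L, M, integral_sub i1 i2, hG.ibp hu t1 t2, ← neg_add', ← integral_add i3 i2, integral_tilde hn]
  congr 1
  refine integral_congr_ae ?_
  filter_upwards [ae_ne_zero hn] with ξ hξ
  have hN := (NN_pos hξ).ne'
  have e1 : ((fun i => cX e i (tilde ξ) * ψ (tilde ξ), fun i => cY e i (tilde ξ) * ψ (tilde ξ)) : V n)
      = ψ (tilde ξ) • ((hh ξ * NN ξ ^ (n + 1)) • Ah ξ e) := by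
    rw [← cvec_tilde]
    refine Prod.ext (funext fun i => ?_) (funext fun i => ?_) <;> simp [mul_comm]
  rw [e1, hdot_smul_right, hdot_smul_right, hdot_comm, hdot_Ah, ← hφψ]
  field_simp

end Heisenberg

namespace Heisenberg
variable {n : ℕ}
set_option linter.unusedVariables false
set_option linter.unusedSimpArgs false

variable {u F : H n → ℝ} {G : H n → V n}

/-- the horizontal gradient of `hh` -/
def gh (ξ : H n) : V n := (fun i => gx i ξ, fun i => gy i ξ)

lemma hGrad_hh {ξ : H n} (h : ξ ≠ 0) : hGrad hh ξ = gh ξ :=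
  Prod.ext (funext fun i => Xd_hh h i) (funext fun i => Yd_hh h i)

lemma diff_hh {ξ : H n} (h : ξ ≠ 0) : DifferentiableAt ℝ (hh : H n → ℝ) ξ :=
  (contDiffAt_hh (k := 1) h).differentiableAt (by simp)

lemma contAt_hdot_gh (e : V n) {ξ : H n} (h : ξ ≠ 0) : ContinuousAt (fun ξ => hdot e (gh ξ)) ξ := by
  unfold hdot gh
  simp only
  refine ContinuousAt.add ?_ ?_
  · exact tendsto_finsetSum _ fun i _ =>
      continuousAt_const.mul (contDiffAt_gx (k := 1) i h).continuousAt
  · exact tendsto_finsetSum _ fun i _ =>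
      continuousAt_const.mul (contDiffAt_gy (k := 1) i h).continuousAt

lemma hh_ibp (hn : 1 ≤ n) (e : V n) {φ : H n → ℝ} (hφ : IsTest {0}ᶜ φ) :
    ∫ ξ, hh ξ * hdot e (hGrad φ ξ) = -∫ ξ, hdot e (gh ξ) * φ ξ := by
  have ht : IsTest {0}ᶜ (fun ξ => hh ξ * φ ξ) := hφ.mulC fun ξ h => contDiffAt_hh h
  have t1 : ∀ i, IsTest univ (fun ξ => e.1 i * (hh ξ * φ ξ)) := fun i => (ht.const_mul _).univ
  have t2 : ∀ i, IsTest univ (fun ξ => e.2 i * (hh ξ * φ ξ)) := fun i => (ht.const_mul _).univ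
  have h1 := goodGrad_one.ibp continuous_const t1 t2
  have h2 : ∫ ξ, hh ξ * hdot e (hGrad φ ξ) = ∫ ξ, ((1 : ℝ) * dvg (fun i ξ => e.1 i * (hh ξ * φ ξ))
      (fun i ξ => e.2 i * (hh ξ * φ ξ)) ξ - hdot e (gh ξ) * φ ξ) := by
    refine integral_congr_ae ?_
    filter_upwards [ae_ne_zero hn] with ξ hξ
    have := dvg_mul (c1 := fun i _ => e.1 i) (c2 := fun i _ => e.2 i)
      (ψ := fun ξ => hh ξ * φ ξ) (ξ := ξ) (fun i => contDiffAt_const) (fun i => contDiffAt_const)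
      (ht.diff ξ)
    rw [this, hGrad_mul (diff_hh hξ) (hφ.diff ξ), hGrad_hh hξ]
    have h0 : dvg (fun i (_ : H n) => e.1 i) (fun i _ => e.2 i) ξ = 0 := by
      simp [dvg, Xd, Yd]
    rw [h0, hdot_add_right, hdot_smul_right, hdot_smul_right]
    ring
  have i1 := int_dvg (u := fun _ => (1:ℝ)) continuous_const t1 t2
  have i2 : Integrable (fun ξ => hdot e (gh ξ) * φ ξ) :=
    (cont_mulC (fun ξ h => contAt_hdot_gh e h) hφ.contDiff.continuous
      hφ.supportSubset).integrable_of_hasCompactSupport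
      (hφ.compactSupport.mul_left (f := fun ξ => hdot e (gh ξ)))
  rw [h2, integral_sub i1 i2, h1]
  simp [hdot]

lemma contAt_JD (e : V n) {ξ : H n} (h : ξ ≠ 0) :
    ContinuousAt (fun ξ => (NN ξ ^ (n + 1))⁻¹ * dvg (cX e) (cY e) (tilde ξ)) ξ := by
  have h1 : ContinuousAt (fun ξ : H n => (NN ξ ^ (n + 1))⁻¹) ξ :=
    ((contDiff_NN (k := 1)).continuous.pow _).continuousAt.inv₀ (pow_ne_zero _ (NN_pos h).ne')
  have h2 : ContinuousAt (dvg (cX e) (cY e)) (tilde ξ) :=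
    contAt_dvg (fun i => contDiffAt_cX e i (tilde_ne h)) (fun i => contDiffAt_cY e i (tilde_ne h))
  exact h1.mul (h2.comp (f := tilde) (contDiffAt_tilde (k := 1) h).continuousAt)

lemma JD_eq (hn : 1 ≤ n) (e : V n) :
    ∀ᵐ ξ : H n, (NN ξ ^ (n + 1))⁻¹ * dvg (cX e) (cY e) (tilde ξ) = hdot e (gh ξ) := by
  have hc : ∀ ξ : H n, ξ ≠ 0 → ContinuousAt (fun ξ =>
      (NN ξ ^ (n + 1))⁻¹ * dvg (cX e) (cY e) (tilde ξ) - hdot e (gh ξ)) ξ := fun ξ h =>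
    (contAt_JD e h).sub (contAt_hdot_gh e h)
  have := (isOpen_compl_singleton (x := (0 : H n))).ae_eq_zero_of_integral_contDiff_smul_eq_zero
    (μ := volume) (f := fun ξ =>
      (NN ξ ^ (n + 1))⁻¹ * dvg (cX e) (cY e) (tilde ξ) - hdot e (gh ξ)) ?_ ?_
  · filter_upwards [this, ae_ne_zero hn] with ξ h1 h2
    exact sub_eq_zero.1 (h1 h2)
  · exact ContinuousOn.locallyIntegrableOn
      (fun ξ hξ => (hc ξ hξ).continuousWithinAt) (measurableSet_singleton 0).compl
  · intro φ h1 h2 h3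
    have hφ : IsTest {0}ᶜ φ := ⟨h1.of_le (by exact_mod_cast le_top), h2, h3⟩
    have k1 := weak_formula hn continuous_const goodGrad_one e hφ
    have k2 := hh_ibp hn e hφ
    have i1 : Integrable (fun ξ => (NN ξ ^ (n + 1))⁻¹ * dvg (cX e) (cY e) (tilde ξ) * φ ξ) :=
      (cont_mulC (fun ξ h => contAt_JD e h) hφ.contDiff.continuous
        hφ.supportSubset).integrable_of_hasCompactSupport
        (hφ.compactSupport.mul_left
          (f := fun ξ => (NN ξ ^ (n + 1))⁻¹ * dvg (cX e) (cY e) (tilde ξ)))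
    have i2 : Integrable (fun ξ => hdot e (gh ξ) * φ ξ) :=
      (cont_mulC (fun ξ h => contAt_hdot_gh e h) hφ.contDiff.continuous
        hφ.supportSubset).integrable_of_hasCompactSupport
        (hφ.compactSupport.mul_left (f := fun ξ => hdot e (gh ξ)))
    have hz : ∀ ξ : H n, hdot e (AT ξ 0) = 0 := by
      intro ξ
      rw [← hdot_Ah]; simp [hdot]
    simp only [hz, mul_one, mul_zero, zero_add, one_mul] at k1
    rw [k2] at k1
    have k3 := neg_injective k1
    simp only [smul_eq_mul]
    have : ∀ ξ, φ ξ * ((NN ξ ^ (n + 1))⁻¹ * dvg (cX e) (cY e) (tilde ξ) - hdot e (gh ξ)) =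
      (NN ξ ^ (n + 1))⁻¹ * dvg (cX e) (cY e) (tilde ξ) * φ ξ - hdot e (gh ξ) * φ ξ := by
      intro ξ; ring
    simp only [this]
    rw [integral_sub i1 i2, k3, sub_self]

/-- the weak gradient of the inversion -/
def Gbar (u : H n → ℝ) (G : H n → V n) (ξ : H n) : V n :=
  hh ξ • AT ξ (G (tilde ξ)) + u (tilde ξ) • gh ξ

lemma crInv_eq {ξ : H n} (h : ξ ≠ 0) : crInv u ξ = hh ξ * u (tilde ξ) := by
  unfold crInv
  rw [gauge_pow_two_n h, div_inv_eq_mul, mul_comm]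

lemma weak_grad (hn : 1 ≤ n) (hu : Continuous u) (hG : GoodGrad u F G) (e : V n) {φ : H n → ℝ}
    (hφ : IsTest {0}ᶜ φ) :
    ∫ ξ, crInv u ξ * hdot e (hGrad φ ξ) = -∫ ξ, hdot e (Gbar u G ξ) * φ ξ := by
  have h1 := weak_formula hn hu hG e hφ
  have h2 : ∫ ξ, crInv u ξ * hdot e (hGrad φ ξ) =
      ∫ ξ, hh ξ * u (tilde ξ) * hdot e (hGrad φ ξ) := by
    refine integral_congr_ae ?_
    filter_upwards [ae_ne_zero hn] with ξ hξ
    rw [crInv_eq hξ]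
  rw [h2, h1]
  congr 1
  refine integral_congr_ae ?_
  filter_upwards [JD_eq hn e] with ξ hξ
  rw [hξ, Gbar, hdot_add_right, hdot_smul_right, hdot_smul_right]

lemma gh_tilde {ξ : H n} (h : ξ ≠ 0) :
    gh ξ = (-(hh ξ) ^ 2) • AT ξ (gh (tilde ξ)) := by
  have h1 : (hh : H n → ℝ) =ᶠ[𝓝 ξ] fun ξ => (fun η => (hh η)⁻¹) (tilde ξ) := by
    filter_upwards [isOpen_compl_singleton.mem_nhds h] with η hη
    rw [hh_tilde hη, inv_inv]
  have ht := tilde_ne h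
  have hp := (hh_pos ht).ne'
  have hd : DifferentiableAt ℝ (fun η : H n => (hh η)⁻¹) (tilde ξ) := (diff_hh ht).inv hp
  have h2 : hGrad (fun η : H n => (hh η)⁻¹) (tilde ξ) = (-(hh ξ) ^ 2) • gh (tilde ξ) := by
    have h3 := hGrad_mul hd (diff_hh ht)
    have h4 : hGrad (fun ξ : H n => (hh ξ)⁻¹ * hh ξ) (tilde ξ) = 0 := by
      have : (fun ξ : H n => (hh ξ)⁻¹ * hh ξ) =ᶠ[𝓝 (tilde ξ)] fun _ => 1 := by
        filter_upwards [isOpen_compl_singleton.mem_nhds ht] with η hη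
        exact inv_mul_cancel₀ (hh_pos hη).ne'
      rw [hGrad_congr this]
      refine Prod.ext (funext fun i => ?_) (funext fun i => ?_) <;> simp [hGrad, Xd, Yd]
    rw [h4, hGrad_hh ht, hh_tilde h, inv_inv] at h3
    have h5 := congrArg (fun w => hh ξ • w) h3
    simp only [smul_zero, smul_add, smul_smul] at h5
    rw [mul_inv_cancel₀ (hh_pos h).ne', one_smul] at h5
    have h6 := eq_neg_of_add_eq_zero_right h5.symm
    rw [h6, neg_smul, sq]
  rw [← hGrad_hh h, hGrad_congr h1, hGrad_comp_tilde h hd, h2]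
  exact (ATL ξ).map_smul _ _

lemma weak_eqn (hn : 1 ≤ n) (hu : Continuous u) (hG : GoodGrad u F G) {φ : H n → ℝ}
    (hφ : IsTest {0}ᶜ φ) :
    ∫ ξ, hdot (Gbar u G ξ) (hGrad φ ξ) = ∫ ξ, F (tilde ξ) / gaugeH ξ ^ (2 * n + 4) * φ ξ := by
  set ψ : H n → ℝ := fun ξ => φ (stil ξ) with hψdef
  have hψ : IsTest {0}ᶜ ψ := hφ.compStil
  have hφψ : ∀ ξ, φ ξ = ψ (tilde ξ) := fun ξ => by simp [hψdef, stil_tilde]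
  have hφψ' : φ = fun ξ => ψ (tilde ξ) := funext hφψ
  have th : IsTest univ (fun ξ => hh ξ * ψ ξ) := (hψ.mulC fun ξ h => contDiffAt_hh h).univ
  have t1 : ∀ i, IsTest univ (fun ξ => gx i ξ * ψ ξ) := fun i =>
    (hψ.mulC fun ξ h => contDiffAt_gx i h).univ
  have t2 : ∀ i, IsTest univ (fun ξ => gy i ξ * ψ ξ) := fun i =>
    (hψ.mulC fun ξ h => contDiffAt_gy i h).univ
  have L : ∫ ξ, hdot (Gbar u G ξ) (hGrad φ ξ) =
      ∫ η, (hh η * hdot (G η) (hGrad ψ η) - u η * hdot (gh η) (hGrad ψ η)) := by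
    rw [integral_tilde hn (fun η => hh η * hdot (G η) (hGrad ψ η) - u η * hdot (gh η) (hGrad ψ η))]
    refine integral_congr_ae ?_
    filter_upwards [ae_ne_zero hn] with ξ hξ
    have hN := (NN_pos hξ).ne'
    have hp := (hh_pos hξ).ne'
    have hs : (NN ξ ^ (n + 1))⁻¹ = hh ξ * hh ξ * (NN ξ)⁻¹ := by
      rw [hh_sq hξ, pow_succ, mul_inv]
    rw [hφψ', hGrad_comp_tilde hξ (hψ.diff _), Gbar, gh_tilde hξ, hdot_add_left, hdot_smul_left,
      hdot_smul_left, hdot_smul_left, hdot_AT hξ, hdot_AT hξ, hs, hh_tilde hξ]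
    field_simp
    ring
  have M : ∫ η, (hh η * hdot (G η) (hGrad ψ η) - u η * hdot (gh η) (hGrad ψ η)) =
      ∫ η, ((hdot (G η) (hGrad (fun ξ => hh ξ * ψ ξ) η)
        - hdot (G η) (fun i => gx i η * ψ η, fun i => gy i η * ψ η))
        - u η * dvg (fun i ξ => gx i ξ * ψ ξ) (fun i ξ => gy i ξ * ψ ξ) η) := by
    refine integral_congr_ae ?_
    filter_upwards [ae_ne_zero hn] with ξ hξ
    have e1 : ((fun i => gx i ξ * ψ ξ, fun i => gy i ξ * ψ ξ) : V n) = ψ ξ • gh ξ := by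
      refine Prod.ext (funext fun i => ?_) (funext fun i => ?_) <;> simp [gh, mul_comm]
    have e2 : dvg gx gy ξ = 0 := subLap_hh hξ
    rw [dvg_mul (fun i => contDiffAt_gx i hξ) (fun i => contDiffAt_gy i hξ) (hψ.diff _), e1, e2,
      hGrad_mul (diff_hh hξ) (hψ.diff _), hGrad_hh hξ, hdot_add_right, hdot_smul_right,
      hdot_smul_right]
    change _ = _ - u ξ * (_ + hdot (gh ξ) _)
    ring
  have i1 := int_dvg hu t1 t2
  have i2 := hG.intDot (fun i => (t1 i).contDiff.continuous) (fun i => (t1 i).compactSupport)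
    (fun i => (t2 i).contDiff.continuous) (fun i => (t2 i).compactSupport)
  have i3 : Integrable (fun η => hdot (G η) (hGrad (fun ξ => hh ξ * ψ ξ) η)) :=
    hG.intDot (fun i => th.Xd_cont i) (fun i => th.Xd_hcs i) (fun i => th.Yd_cont i)
      (fun i => th.Yd_hcs i)
  have i4 : Integrable (fun η => hdot (G η) (hGrad (fun ξ => hh ξ * ψ ξ) η)
      - hdot (G η) (fun i => gx i η * ψ η, fun i => gy i η * ψ η)) := i3.sub i2
  rw [L, M, integral_sub i4 i1, integral_sub i3 i2, hG.ibp hu t1 t2, hG.eqn _ th,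
    sub_neg_eq_add, sub_add_cancel, integral_tilde hn]
  refine integral_congr_ae ?_
  filter_upwards [ae_ne_zero hn] with ξ hξ
  have hN := (NN_pos hξ).ne'
  have hp := (hh_pos hξ).ne'
  have hs : (NN ξ ^ (n + 1))⁻¹ = hh ξ * hh ξ * (NN ξ)⁻¹ := by
    rw [hh_sq hξ, pow_succ, mul_inv]
  rw [gauge_pow_two_n_four hξ, hs, hh_tilde hξ, ← hφψ]
  field_simp

end Heisenberg

namespace Heisenberg
variable {n : ℕ}
set_option linter.unusedVariables false
set_option linter.unusedSimpArgs false

variable {u F : H n → ℝ} {G : H n → V n}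

lemma memLp_cmul {K : Set (H n)} (hK : IsCompact K) {c a : H n → ℝ} (hc : ContinuousOn c K)
    (ha : MemLp a 2 (volume.restrict K)) :
    MemLp (fun ξ => c ξ * a ξ) 2 (volume.restrict K) := by
  have hm : AEStronglyMeasurable (fun ξ => c ξ * a ξ) (volume.restrict K) :=
    (hc.aestronglyMeasurable hK.measurableSet).mul ha.1
  rw [memLp_two_iff_integrable_sq hm]
  have h1 : IntegrableOn (fun ξ => a ξ ^ 2) K := (memLp_two_iff_integrable_sq ha.1).1 ha
  have h2 := h1.continuousOn_mul (hc.pow 2) hK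
  refine h2.congr (Eventually.of_forall fun ξ => ?_)
  simp only [Pi.mul_apply, Pi.pow_apply]
  ring

lemma memLp_comp_tilde {K : Set (H n)} (hK : IsCompact K) (h0 : K ⊆ {0}ᶜ) {a : H n → ℝ}
    (ha : LocallyIntegrable a) (ha2 : ∀ K : Set (H n), IsCompact K → IntegrableOn (fun ξ => a ξ ^ 2) K) :
    MemLp (fun ξ => a (tilde ξ)) 2 (volume.restrict K) := by
  have hct : ContinuousOn tilde K := fun ξ h =>
    ((contDiffAt_tilde (k := 1) (h0 h)).continuousAt).continuousWithinAt
  have hK' : IsCompact (tilde '' K) := hK.image_of_continuousOn hct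
  have hN : ContinuousOn (fun ξ : H n => NN ξ ^ (n + 1)) K :=
    ((contDiff_NN (k := 1)).continuous.pow _).continuousOn
  have key : ∀ b : H n → ℝ, IntegrableOn b (tilde '' K) → IntegrableOn (fun ξ => b (tilde ξ)) K := by
    intro b hb
    have h1 := ((integrableOn_tilde hK.measurableSet h0 b).1 hb).continuousOn_mul hN hK
    refine h1.congr_fun (fun ξ hξ => ?_) hK.measurableSet
    have := (pow_pos (NN_pos (h0 hξ)) (n + 1)).ne'
    simp only
    field_simp
  have h1 := key a (ha.integrableOn_isCompact hK')
  rw [memLp_two_iff_integrable_sq h1.aestronglyMeasurable]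
  exact key _ (ha2 _ hK')

lemma GoodGrad.sqX (hG : GoodGrad u F G) (i : Fin n) (K : Set (H n)) (hK : IsCompact K) :
    IntegrableOn (fun ξ => (G ξ).1 i ^ 2) K := by
  refine Integrable.mono (hG.weak.locSq K (subset_univ _) hK) ((hG.mX i).restrict.pow 2)
    (Eventually.of_forall fun ξ => ?_)
  rw [Real.norm_of_nonneg (by positivity), Real.norm_of_nonneg (by positivity), ← sq_abs]
  gcongr
  exact (norm_le_pi_norm (G ξ).1 i).trans (norm_fst_le _)

lemma GoodGrad.sqY (hG : GoodGrad u F G) (i : Fin n) (K : Set (H n)) (hK : IsCompact K) :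
    IntegrableOn (fun ξ => (G ξ).2 i ^ 2) K := by
  refine Integrable.mono (hG.weak.locSq K (subset_univ _) hK) ((hG.mY i).restrict.pow 2)
    (Eventually.of_forall fun ξ => ?_)
  rw [Real.norm_of_nonneg (by positivity), Real.norm_of_nonneg (by positivity), ← sq_abs]
  gcongr
  exact (norm_le_pi_norm (G ξ).2 i).trans (norm_snd_le _)

lemma memLp_hdot_Gbar (hu : Continuous u) (hG : GoodGrad u F G) (e : V n) {K : Set (H n)}
    (hK : IsCompact K) (h0 : K ⊆ {0}ᶜ) :
    MemLp (fun ξ => hdot e (Gbar u G ξ)) 2 (volume.restrict K) := by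
  have hct : ContinuousOn tilde K := fun ξ h =>
    ((contDiffAt_tilde (k := 1) (h0 h)).continuousAt).continuousWithinAt
  have hch : ContinuousOn hh K := fun ξ h =>
    ((contDiffAt_hh (k := 1) (h0 h)).continuousAt).continuousWithinAt
  have hA1 : ∀ j, ContinuousOn (fun ξ => (Ah ξ e).1 j) K := fun j ξ h =>
    ((contDiffAt_Ah1 (k := 1) e j (h0 h)).continuousAt).continuousWithinAt
  have hA2 : ∀ j, ContinuousOn (fun ξ => (Ah ξ e).2 j) K := fun j ξ h =>
    ((contDiffAt_Ah2 (k := 1) e j (h0 h)).continuousAt).continuousWithinAt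
  have hg : ContinuousOn (fun ξ => hdot e (gh ξ)) K := fun ξ h =>
    (contAt_hdot_gh e (h0 h)).continuousWithinAt
  have hE : (fun ξ => hdot e (Gbar u G ξ)) = fun ξ =>
      (hh ξ * ((∑ j, (Ah ξ e).1 j * (G (tilde ξ)).1 j) + ∑ j, (Ah ξ e).2 j * (G (tilde ξ)).2 j))
      + u (tilde ξ) * hdot e (gh ξ) := by
    funext ξ
    rw [Gbar, hdot_add_right, hdot_smul_right, hdot_smul_right, ← hdot_Ah]
    rfl
  rw [hE]
  refine MemLp.add (memLp_cmul hK hch (MemLp.add ?_ ?_)) ?_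
  · exact memLp_finsetSum _ fun j _ => memLp_cmul hK (hA1 j)
      (memLp_comp_tilde hK h0 (hG.locX j) (hG.sqX j))
  · exact memLp_finsetSum _ fun j _ => memLp_cmul hK (hA2 j)
      (memLp_comp_tilde hK h0 (hG.locY j) (hG.sqY j))
  · have hc : ContinuousOn (fun ξ => u (tilde ξ) * hdot e (gh ξ)) K :=
      (hu.comp_continuousOn hct).mul hg
    rw [memLp_two_iff_integrable_sq (hc.aestronglyMeasurable hK.measurableSet)]
    exact (hc.pow 2).integrableOn_compact hK

def eX (i : Fin n) : V n := (Pi.single i 1, 0)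
def eY (i : Fin n) : V n := (0, Pi.single i 1)

lemma hdot_eX (i : Fin n) (w : V n) : hdot (eX i) w = w.1 i := by
  simp [hdot, eX, Pi.single_apply]
lemma hdot_eY (i : Fin n) (w : V n) : hdot (eY i) w = w.2 i := by
  simp [hdot, eY, Pi.single_apply]

lemma V_norm_sq (w : V n) : ‖w‖ ^ 2 ≤ ∑ i, w.1 i ^ 2 + ∑ i, w.2 i ^ 2 := by
  set S := ∑ i, w.1 i ^ 2 + ∑ i, w.2 i ^ 2 with hS
  have h1 : 0 ≤ ∑ i, w.1 i ^ 2 := by positivity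
  have h2 : 0 ≤ ∑ i, w.2 i ^ 2 := by positivity
  have hw : ‖w‖ ≤ √S := by
    rw [Prod.norm_def]
    refine max_le ?_ ?_
    · refine (pi_norm_le_iff_of_nonneg (Real.sqrt_nonneg _)).2 fun i => Real.abs_le_sqrt ?_
      have := Finset.single_le_sum (f := fun i => w.1 i ^ 2) (fun i _ => sq_nonneg _)
        (Finset.mem_univ i)
      linarith
    · refine (pi_norm_le_iff_of_nonneg (Real.sqrt_nonneg _)).2 fun i => Real.abs_le_sqrt ?_
      have := Finset.single_le_sum (f := fun i => w.2 i ^ 2) (fun i _ => sq_nonneg _)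
        (Finset.mem_univ i)
      linarith
  calc ‖w‖ ^ 2 ≤ √S ^ 2 := by gcongr
    _ = S := Real.sq_sqrt (by positivity)

lemma locSq_Gbar (hu : Continuous u) (hG : GoodGrad u F G) {K : Set (H n)}
    (h0 : K ⊆ {0}ᶜ) (hK : IsCompact K) : IntegrableOn (fun ξ => ‖Gbar u G ξ‖ ^ 2) K := by
  have m1 : ∀ i, MemLp (fun ξ => (Gbar u G ξ).1 i) 2 (volume.restrict K) := fun i => by
    simpa only [hdot_eX] using memLp_hdot_Gbar hu hG (eX i) hK h0
  have m2 : ∀ i, MemLp (fun ξ => (Gbar u G ξ).2 i) 2 (volume.restrict K) := fun i => by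
    simpa only [hdot_eY] using memLp_hdot_Gbar hu hG (eY i) hK h0
  have hm : AEMeasurable (Gbar u G) (volume.restrict K) :=
    AEMeasurable.prodMk (aemeasurable_pi_lambda _ fun i => (m1 i).1.aemeasurable)
      (aemeasurable_pi_lambda _ fun i => (m2 i).1.aemeasurable)
  have hI : IntegrableOn (fun ξ => ∑ i, (Gbar u G ξ).1 i ^ 2 + ∑ i, (Gbar u G ξ).2 i ^ 2) K :=
    (integrable_finsetSum _ fun i _ => (memLp_two_iff_integrable_sq (m1 i).1).1 (m1 i)).add
      (integrable_finsetSum _ fun i _ => (memLp_two_iff_integrable_sq (m2 i).1).1 (m2 i))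
  refine Integrable.mono hI ((hm.norm.pow_const 2).aestronglyMeasurable) (Eventually.of_forall fun ξ => ?_)
  rw [Real.norm_of_nonneg (by positivity), Real.norm_of_nonneg (by positivity)]
  exact V_norm_sq _

lemma contOn_crInv (hu : Continuous u) : ContinuousOn (crInv u) ({0}ᶜ : Set (H n)) := by
  have : ContinuousOn (fun ξ => hh ξ * u (tilde ξ)) ({0}ᶜ : Set (H n)) := fun ξ h =>
    ((contDiffAt_hh (k := 1) h).continuousAt.mul
      (hu.continuousAt.comp (contDiffAt_tilde (k := 1) h).continuousAt)).continuousWithinAt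
  exact this.congr fun ξ h => crInv_eq h

theorem weakSol_crInv (hn : 1 ≤ n) (hu : Continuous u) (hF : Continuous F)
    (hc : IsCylindrical u) (h : IsWeakSol univ u F) {R : H n → ℝ}
    (hR : ∀ ξ, ξ ≠ 0 → R ξ = F (tilde ξ) / gaugeH ξ ^ (2 * n + 4)) :
    IsWeakSol ({0}ᶜ : Set (H n)) (crInv u) R := by
  obtain ⟨G, hG⟩ := exists_goodGrad hu hF hc h
  refine ⟨Gbar u G, ⟨?_, fun K h0 hK => locSq_Gbar hu hG h0 hK, ?_, ?_⟩, ?_⟩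
  · exact (contOn_crInv hu).locallyIntegrableOn (measurableSet_singleton 0).compl
  · intro i φ hφ
    simpa only [hdot_eX, hGrad] using weak_grad hn hu hG (eX i) hφ
  · intro i φ hφ
    simpa only [hdot_eY, hGrad] using weak_grad hn hu hG (eY i) hφ
  · intro φ hφ
    rw [weak_eqn hn hu hG hφ]
    refine integral_congr_ae ?_
    filter_upwards [ae_ne_zero hn] with ξ hξ
    rw [hR ξ hξ]

lemma gauge_crInv {ξ : H n} (h : ξ ≠ 0) : gaugeH ξ ^ (2 * n) * crInv u ξ = u (tilde ξ) := by
  rw [crInv_eq h, gauge_pow_two_n h, inv_mul_cancel_left₀ (hh_pos h).ne']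

lemma gauge_eq_zero_iff {ξ : H n} : gaugeH ξ = 0 ↔ ξ = 0 := by
  rw [← NN_eq_zero, ← gauge_pow_four]; simp

lemma gauge_cont : Continuous (gaugeH : H n → ℝ) := by
  change Continuous fun ξ : H n => NN ξ ^ ((4 : ℝ)⁻¹)
  exact (contDiff_NN (k := 1)).continuous.rpow_const fun ξ => Or.inr (by norm_num)

lemma norm_le_of_NN {ξ : H n} {c : ℝ} (hc : 0 ≤ c) (h : NN ξ ≤ c ^ 4) : ‖ξ‖ ≤ max c (c ^ 2) := by
  have hr : rsq ξ ≤ c ^ 2 := by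
    refine le_of_sq_le_sq ?_ (by positivity)
    unfold NN at h
    nlinarith [sq_nonneg ξ.2.2]
  have ht : |ξ.2.2| ≤ c ^ 2 := by
    refine abs_le_of_sq_le_sq ?_ (by positivity)
    unfold NN at h
    nlinarith [sq_nonneg (rsq ξ)]
  have h1 : 0 ≤ ∑ i, ξ.1 i ^ 2 := by positivity
  have h2 : 0 ≤ ∑ i, ξ.2.1 i ^ 2 := by positivity
  have hd : rsq ξ = ∑ i, ξ.1 i ^ 2 + ∑ i, ξ.2.1 i ^ 2 := rfl
  have hM : 0 ≤ max c (c ^ 2) := le_max_of_le_left hc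
  rw [Prod.norm_def, Prod.norm_def]
  refine max_le ?_ (max_le ?_ (ht.trans (le_max_right _ _)))
  · refine (pi_norm_le_iff_of_nonneg hM).2 fun i => le_max_of_le_left (abs_le_of_sq_le_sq ?_ hc)
    have := Finset.single_le_sum (f := fun i => ξ.1 i ^ 2) (fun i _ => sq_nonneg _)
        (Finset.mem_univ i)
    linarith
  · refine (pi_norm_le_iff_of_nonneg hM).2 fun i => le_max_of_le_left (abs_le_of_sq_le_sq ?_ hc)
    have := Finset.single_le_sum (f := fun i => ξ.2.1 i ^ 2) (fun i _ => sq_nonneg _)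
        (Finset.mem_univ i)
    linarith

lemma norm_tilde_le {ξ : H n} (h : ξ ≠ 0) :
    ‖tilde ξ‖ ≤ max (gaugeH ξ)⁻¹ ((gaugeH ξ)⁻¹ ^ 2) := by
  refine norm_le_of_NN (inv_nonneg.2 (gauge_nonneg _)) ?_
  rw [NN_tilde, inv_pow, gauge_pow_four]

theorem tendsto_crInv (hu : Continuous u) :
    Tendsto (fun ξ : H n => gaugeH ξ ^ (2 * n) * crInv u ξ) (comap gaugeH atTop) (𝓝 (u 0)) := by
  have hne : ∀ᶠ ξ : H n in comap gaugeH atTop, ξ ≠ 0 := by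
    filter_upwards [tendsto_comap.eventually (eventually_gt_atTop (0 : ℝ))] with ξ hξ h
    exact hξ.ne' (gauge_eq_zero_iff.2 h)
  have h1 : Tendsto (fun ξ : H n => (gaugeH ξ)⁻¹) (comap gaugeH atTop) (𝓝 0) :=
    tendsto_inv_atTop_zero.comp tendsto_comap
  have h2 : Tendsto (fun ξ : H n => max (gaugeH ξ)⁻¹ ((gaugeH ξ)⁻¹ ^ 2)) (comap gaugeH atTop)
      (𝓝 0) := by simpa using h1.max (h1.pow 2)
  have h3 : Tendsto (tilde : H n → H n) (comap gaugeH atTop) (𝓝 0) :=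
    squeeze_zero_norm' (hne.mono fun ξ h => norm_tilde_le h) h2
  refine ((hu.tendsto 0).comp h3).congr' ?_
  filter_upwards [hne] with ξ h
  exact (gauge_crInv h).symm

lemma hh_rpow {ξ : H n} (hn : 1 ≤ n) (h : ξ ≠ 0) : hh ξ ^ (tau n + 1) = (NN ξ ^ (n + 1))⁻¹ := by
  have hn' : (n : ℝ) ≠ 0 := by positivity
  unfold hh tau
  rw [← Real.rpow_mul (NN_nonneg ξ), ← Real.rpow_natCast, ← Real.rpow_neg (NN_nonneg ξ)]
  congr 1
  push_cast
  field_simp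
  ring

theorem decay_crInv (hn : 1 ≤ n) (hu : Continuous u) {r : ℝ} (hr : 0 < r) :
    IntegrableOn (fun ξ => |crInv u ξ| ^ (tau n + 1)) {ξ : H n | r ≤ gaugeH ξ} ∧
        ∃ M : ℝ, ∀ ξ : H n, r ≤ gaugeH ξ → |crInv u ξ| ≤ M := by
  have hne : ∀ ξ : H n, r ≤ gaugeH ξ → ξ ≠ 0 := fun ξ h h' =>
    (hr.trans_le h).ne' (gauge_eq_zero_iff.2 h')
  set B : Set (H n) := Metric.closedBall 0 (max r⁻¹ (r⁻¹ ^ 2)) with hB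
  have hBc : IsCompact B := isCompact_closedBall _ _
  have hmem : ∀ ξ : H n, r ≤ gaugeH ξ → tilde ξ ∈ B := fun ξ h => by
    rw [hB, mem_closedBall_zero_iff]
    have hi : (gaugeH ξ)⁻¹ ≤ r⁻¹ := inv_anti₀ hr h
    have h0 : 0 ≤ (gaugeH ξ)⁻¹ := inv_nonneg.2 (gauge_nonneg _)
    exact (norm_tilde_le (hne ξ h)).trans (max_le_max hi (pow_le_pow_left₀ h0 hi 2))
  have ht : 0 ≤ tau n + 1 := by unfold tau; positivity
  have hs : MeasurableSet {ξ : H n | r ≤ gaugeH ξ} :=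
    measurableSet_le measurable_const gauge_cont.measurable
  constructor
  · have hc : Continuous fun ξ => |u ξ| ^ (tau n + 1) :=
      hu.abs.rpow_const fun ξ => Or.inr ht
    have h1 : IntegrableOn (fun ξ => |u ξ| ^ (tau n + 1)) (tilde '' {ξ : H n | r ≤ gaugeH ξ}) :=
      (hc.continuousOn.integrableOn_compact hBc).mono_set (image_subset_iff.2 hmem)
    rw [integrableOn_tilde hs hne] at h1
    refine h1.congr_fun (fun ξ hξ => ?_) hs
    have hξ' := hne ξ hξ
    simp only
    rw [crInv_eq hξ', abs_mul, abs_of_pos (hh_pos hξ'), mul_rpow (hh_pos hξ').le (abs_nonneg _),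
      hh_rpow hn hξ']
  · obtain ⟨C, hC⟩ := hBc.exists_bound_of_continuousOn hu.continuousOn
    refine ⟨C / r ^ (2 * n), fun ξ h => ?_⟩
    have hg := gauge_nonneg ξ
    have hb := hC _ (hmem ξ h)
    unfold crInv
    rw [abs_div, abs_of_nonneg (pow_nonneg hg (2 * n))]
    exact div_le_div₀ ((norm_nonneg _).trans hb) hb (by positivity) (pow_le_pow_left₀ hr.le h _)

theorem main' (n : ℕ) (hn : 1 ≤ n)
    (u v : H n → ℝ) (f : ℝ → ℝ)
    (hu_cont : Continuous u) (hv_cont : Continuous v)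
    (hv_pos : ∀ ξ, 0 < v ξ)
    (hu_cyl : IsCylindrical u)
    (hu_sol : IsWeakSol Set.univ u (fun ξ => f (v ξ)))
    (hf_cont : ContinuousOn f (Set.Ici 0)) :
    IsWeakSol ({(0 : H n)}ᶜ) (crInv u)
      (fun ξ => f (gaugeH ξ ^ (2 * n) * crInv v ξ) / gaugeH ξ ^ (2 * n + 4)) :=
  weakSol_crInv hn hu_cont (hf_cont.comp_continuous hv_cont fun ξ => (hv_pos ξ).le) hu_cyl hu_sol
    fun ξ h => by rw [gauge_crInv h]; rfl

end Heisenberg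

namespace Heisenberg

/-- **Lemma 3.1.** If `(u,v)` is a positive cylindrical weak solution of
`−Δ_ℍ u = f(v)`, `−Δ_ℍ v = g(u)` on `ℍⁿ`, then the CR inversions `(ū, v̄)` form a weak
solution of `−Δ_ℍ ū = |ξ|_ℍ^{−(Q+2)} f(|ξ|_ℍ^{Q−2} v̄)`,
`−Δ_ℍ v̄ = |ξ|_ℍ^{−(Q+2)} g(|ξ|_ℍ^{Q−2} ū)` on `ℍⁿ ∖ {0}`; moreover
`|ξ|_ℍ^{Q−2} ū(ξ) → u(0)` and `|ξ|_ℍ^{Q−2} v̄(ξ) → v(0)` as `|ξ|_ℍ → ∞`, and hence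
`ū, v̄ ∈ L^{τ+1} ∩ L^∞` on `ℍⁿ ∖ B_r(0)` for every `r > 0`, where `τ = (Q+2)/(Q−2)`
and `Q = 2n+2` (so `Q − 2 = 2n` and `Q + 2 = 2n + 4`). -/
theorem crInv_weak_solution_and_decay (n : ℕ) (hn : 1 ≤ n)
    (u v : H n → ℝ) (f g : ℝ → ℝ)
    (hu_cont : Continuous u) (hv_cont : Continuous v)
    (hu_pos : ∀ ξ, 0 < u ξ) (hv_pos : ∀ ξ, 0 < v ξ)
    (hu_cyl : IsCylindrical u) (hv_cyl : IsCylindrical v)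
    (hu_sol : IsWeakSol Set.univ u (fun ξ => f (v ξ)))
    (hv_sol : IsWeakSol Set.univ v (fun ξ => g (u ξ)))
    (hf_cont : ContinuousOn f (Set.Ici 0))
    (hg_cont : ContinuousOn g (Set.Ici 0)) :
    IsWeakSol ({(0 : H n)}ᶜ) (crInv u)
      (fun ξ => f (gaugeH ξ ^ (2 * n) * crInv v ξ) / gaugeH ξ ^ (2 * n + 4)) ∧
    IsWeakSol ({(0 : H n)}ᶜ) (crInv v)
      (fun ξ => g (gaugeH ξ ^ (2 * n) * crInv u ξ) / gaugeH ξ ^ (2 * n + 4)) ∧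
    Filter.Tendsto (fun ξ : H n => gaugeH ξ ^ (2 * n) * crInv u ξ)
      (Filter.comap gaugeH Filter.atTop) (nhds (u 0)) ∧
    Filter.Tendsto (fun ξ : H n => gaugeH ξ ^ (2 * n) * crInv v ξ)
      (Filter.comap gaugeH Filter.atTop) (nhds (v 0)) ∧
    ∀ r : ℝ, 0 < r →
      (IntegrableOn (fun ξ => |crInv u ξ| ^ (tau n + 1)) {ξ : H n | r ≤ gaugeH ξ} ∧
        ∃ M : ℝ, ∀ ξ : H n, r ≤ gaugeH ξ → |crInv u ξ| ≤ M) ∧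
      (IntegrableOn (fun ξ => |crInv v ξ| ^ (tau n + 1)) {ξ : H n | r ≤ gaugeH ξ} ∧
        ∃ M : ℝ, ∀ ξ : H n, r ≤ gaugeH ξ → |crInv v ξ| ≤ M) := by
  exact ⟨main' n hn u v f hu_cont hv_cont hv_pos hu_cyl hu_sol hf_cont,
    main' n hn v u g hv_cont hu_cont hu_pos hv_cyl hv_sol hg_cont,
    tendsto_crInv hu_cont, tendsto_crInv hv_cont,
    fun r hr => ⟨decay_crInv hn hu_cont hr, decay_crInv hn hv_cont hr⟩⟩

end Heisenberg
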